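/- Let G = F ∗ A₁ ∗ ⋯ ∗ A_k be the free product of a free group F of finite rank and finitely many free abelian groups A₁,…,A_k of finite ranks, with finite generating set B consisting of a basis of F together with bases of the A_i. There exists a constant N (depending only on G) with the following property: for every orientable quadratic word Q over G, if the equation Q = 1 has a solution in G, then it has a solution α such that for every variable x, the word length |α(x)| with respect to B satisfies |α(x)| ≤ N·(n(Q) + c(Q))², where n(Q) is the number of variables of Q and c(Q) is the total number of occurrences of letters of B in Q. -/

import Mathlib

/- G = F ∗ A₁ ∗ ⋯ ∗ A_k : free product of a free group of finite rank r and
free abelian groups of finite ranks, with generating set B a basis of F together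
with bases of the Aᵢ. -/

namespace Stmt0

/-- The family of factors: index `none` is the free group, `some i` the i-th free
abelian group (written multiplicatively). -/
def Fam (r k : ℕ) (ranks : Fin k → ℕ) : Option (Fin k) → Type
  | none => FreeGroup (Fin r)
  | some i => Multiplicative (Fin (ranks i) →₀ ℤ)

noncomputable instance (r k : ℕ) (ranks : Fin k → ℕ) : (i : Option (Fin k)) → Group (Fam r k ranks i)
  | none => inferInstanceAs (Group (FreeGroup (Fin r)))
  | some i => inferInstanceAs (Group (Multiplicative (Fin (ranks i) →₀ ℤ)))

/-- The free product G = F ∗ A₁ ∗ ⋯ ∗ A_k. -/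
abbrev G (r k : ℕ) (ranks : Fin k → ℕ) : Type := Monoid.CoprodI (Fam r k ranks)

/-- The generating set: a basis of F together with a basis of each Aᵢ. -/
abbrev B (r k : ℕ) (ranks : Fin k → ℕ) : Type := Fin r ⊕ (Σ i : Fin k, Fin (ranks i))

/-- The generators of G indexed by B. -/
noncomputable def gen (r k : ℕ) (ranks : Fin k → ℕ) : B r k ranks → G r k ranks
  | Sum.inl j => Monoid.CoprodI.of (M := Fam r k ranks) (i := none)
      (show Fam r k ranks none from FreeGroup.of j)
  | Sum.inr ⟨i, j⟩ => Monoid.CoprodI.of (M := Fam r k ranks) (i := some i)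
      (show Fam r k ranks (some i) from Multiplicative.ofAdd (Finsupp.single j (1 : ℤ)))

/-- Word length of an element of G with respect to the generating set B:
the least n such that the element is a product of n elements of B ∪ B⁻¹. -/
noncomputable def wl (r k : ℕ) (ranks : Fin k → ℕ) (x : G r k ranks) : ℕ :=
  sInf {n | ∃ l : List (G r k ranks), l.length = n ∧
    (∀ y ∈ l, ∃ b, y = gen r k ranks b ∨ y = (gen r k ranks b)⁻¹) ∧ l.prod = x}

/-- Number of occurrences of the variable x (as x or x⁻¹) in the reduced word Q. -/
def occ {β : Type} [DecidableEq β] {nv : ℕ} (Q : FreeGroup (Fin nv ⊕ β)) (x : Fin nv) : ℕ :=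
  (Q.toWord.filter fun l => decide (l.1 = Sum.inl x)).length

/-- Number of occurrences of the variable x with the given sign in the reduced word Q. -/
def occS {β : Type} [DecidableEq β] {nv : ℕ} (Q : FreeGroup (Fin nv ⊕ β)) (x : Fin nv)
    (s : Bool) : ℕ :=
  (Q.toWord.filter fun l => decide (l.1 = Sum.inl x) && (l.2 == s)).length

/-- c(Q): the total number of occurrences of letters of B in the reduced word Q. -/
def cLen {β : Type} [DecidableEq β] {nv : ℕ} (Q : FreeGroup (Fin nv ⊕ β)) : ℕ :=
  (Q.toWord.filter fun l => l.1.isRight).length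

/-- A solution of the equation Q = 1 in G: a homomorphism F(X ∪ B) → G sending each
letter of B to the corresponding generator of G and killing Q. -/
def IsSol (r k : ℕ) (ranks : Fin k → ℕ) {nv : ℕ} (Q : FreeGroup (Fin nv ⊕ B r k ranks))
    (α : FreeGroup (Fin nv ⊕ B r k ranks) →* G r k ranks) : Prop :=
  (∀ b, α (FreeGroup.of (Sum.inr b)) = gen r k ranks b) ∧ α Q = 1


/-- Letters: signed variables or coefficient labels. -/
abbrev Lt (V C : Type) := (V × Bool) ⊕ C

section basics
variable {V C : Type}

/-- The word does not contain the variable `v`. -/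
def Avoid (v : V) (l : List (Lt V C)) : Prop := ∀ b, Sum.inl (v, b) ∉ l

/-- The word contains no complete pair. -/
def NoPair (l : List (Lt V C)) : Prop := ∀ v b, Sum.inl (v, b) ∈ l → Sum.inl (v, !b) ∉ l

def Quad (l : List (Lt V C)) : Prop :=
  l.Nodup ∧ ∀ v b, Sum.inl (v, b) ∈ l → Sum.inl (v, !b) ∈ l

def Full (l : List (Lt V C)) : Prop := l.Nodup ∧ ∀ x, x ∈ l

theorem Full.quad {l : List (Lt V C)} (h : Full l) : Quad l := ⟨h.1, fun _ _ _ => h.2 _⟩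

theorem Full.perm {l l' : List (Lt V C)} (h : Full l) (p : l.Perm l') : Full l' :=
  ⟨p.nodup_iff.1 h.1, fun x => p.mem_iff.1 (h.2 x)⟩

@[simp] theorem avoid_nil (v : V) : Avoid v ([] : List (Lt V C)) := by simp [Avoid]

@[simp] theorem avoid_append (v : V) (l l' : List (Lt V C)) :
    Avoid v (l ++ l') ↔ Avoid v l ∧ Avoid v l' := by
  simp only [Avoid, List.mem_append, not_or]; exact forall_and

@[simp] theorem avoid_cons_inl (v u : V) (b : Bool) (l : List (Lt V C)) :
    Avoid v (Sum.inl (u, b) :: l) ↔ v ≠ u ∧ Avoid v l := by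
  simp only [Avoid, List.mem_cons, not_or, Sum.inl.injEq, Prod.mk.injEq]
  constructor
  · intro h
    exact ⟨fun e => (h b).1 ⟨e, rfl⟩, fun b => (h b).2⟩
  · rintro ⟨h1, h2⟩ b
    exact ⟨fun e => h1 e.1, h2 b⟩

@[simp] theorem avoid_cons_inr (v : V) (a : C) (l : List (Lt V C)) :
    Avoid v (Sum.inr a :: l) ↔ Avoid v l := by
  simp [Avoid]

@[simp] theorem avoid_map_inr (v : V) (l : List C) :
    Avoid v (l.map Sum.inr : List (Lt V C)) := by
  simp [Avoid]

/-- splitting at both occurrences, given order -/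
theorem split_pair [DecidableEq V] {l : List (Lt V C)} (h : Quad l) (v : V) (b : Bool)
    (hm : Sum.inl (v, b) ∈ l) :
    ∃ b P R S, l = P ++ Sum.inl (v, b) :: (R ++ Sum.inl (v, !b) :: S) ∧
      Avoid v P ∧ Avoid v R ∧ Avoid v S := by
  obtain ⟨P, T, rfl⟩ := List.append_of_mem hm
  have h2 := h.2 v b hm
  have hn := h.1
  rw [List.mem_append, List.mem_cons] at h2
  have key : ∀ (b : Bool) (P R S : List (Lt V C)),
      (P ++ Sum.inl (v, b) :: (R ++ Sum.inl (v, !b) :: S)).Nodup →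
        Avoid v P ∧ Avoid v R ∧ Avoid v S := by
    intro b P R S hn
    simp only [List.nodup_append, List.nodup_cons, List.mem_append, List.mem_cons] at hn
    refine ⟨?_, ?_, ?_⟩ <;> intro b' hb' <;> rcases Bool.eq_or_eq_not b' b with rfl | rfl <;> grind
  rcases h2 with h2 | h2 | h2
  · obtain ⟨P', R, rfl⟩ := List.append_of_mem h2
    have e : P' ++ Sum.inl (v, !b) :: R ++ Sum.inl (v, b) :: T
        = P' ++ Sum.inl (v, !b) :: (R ++ Sum.inl (v, !!b) :: T) := by simp
    rw [e] at hn
    exact ⟨!b, P', R, T, e, key _ _ _ _ hn⟩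
  · simp at h2
  · obtain ⟨R, S, rfl⟩ := List.append_of_mem h2
    exact ⟨b, P, R, S, rfl, key _ _ _ _ hn⟩

end basics

section values
variable {V C : Type} {Γ : Type} [Group Γ]

def gv (f : V → Γ) (k : C → Γ) : Lt V C → Γ
  | Sum.inl (v, true) => f v
  | Sum.inl (v, false) => (f v)⁻¹
  | Sum.inr a => k a

def ev (f : V → Γ) (k : C → Γ) (l : List (Lt V C)) : Γ := (l.map (gv f k)).prod

/-- value of a coefficient word -/
def cv (k : C → Γ) (l : List C) : Γ := (l.map k).prod

@[simp] theorem ev_nil (f : V → Γ) (k : C → Γ) : ev f k [] = 1 := rfl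
@[simp] theorem ev_cons (f : V → Γ) (k : C → Γ) (x) (l) : ev f k (x :: l) = gv f k x * ev f k l := by
  simp [ev]
@[simp] theorem ev_append (f : V → Γ) (k : C → Γ) (l l') :
    ev f k (l ++ l') = ev f k l * ev f k l' := by
  simp [ev]
@[simp] theorem cv_nil (k : C → Γ) : cv k [] = 1 := rfl
@[simp] theorem cv_cons (k : C → Γ) (x) (l) : cv k (x :: l) = k x * cv k l := by
  simp [cv]
@[simp] theorem cv_append (k : C → Γ) (l l') : cv k (l ++ l') = cv k l * cv k l' := by
  simp [cv]
@[simp] theorem ev_map_inr (f : V → Γ) (k : C → Γ) (l : List C) :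
    ev f k (l.map Sum.inr) = cv k l := by
  simp [ev, cv, Function.comp_def, gv]
@[simp] theorem gv_inr (f : V → Γ) (k : C → Γ) (a : C) : gv f k (Sum.inr a) = k a := rfl

theorem gv_bar (f : V → Γ) (k : C → Γ) (v : V) (b : Bool) :
    gv f k (Sum.inl (v, !b)) = (gv f k (Sum.inl (v, b)))⁻¹ := by
  cases b <;> simp [gv]

variable [DecidableEq V]

def setv (f : V → Γ) (v : V) (b : Bool) (y : Γ) : V → Γ :=
  Function.update f v (if b then y else y⁻¹)

theorem gv_setv (f : V → Γ) (k : C → Γ) (v : V) (b : Bool) (y : Γ) :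
    gv (setv f v b y) k (Sum.inl (v, b)) = y := by
  cases b <;> simp [gv, setv]

theorem gv_setv_bar (f : V → Γ) (k : C → Γ) (v : V) (b : Bool) (y : Γ) :
    gv (setv f v b y) k (Sum.inl (v, !b)) = y⁻¹ := by
  rw [gv_bar, gv_setv]

theorem gv_setv_ne (f : V → Γ) (k : C → Γ) (v : V) (b : Bool) (y : Γ) (x : Lt V C)
    (h : ∀ b, x ≠ Sum.inl (v, b)) : gv (setv f v b y) k x = gv f k x := by
  rcases x with ⟨u, b'⟩ | a
  · have : u ≠ v := fun e => h b' (by rw [e])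
    cases b' <;> simp [gv, setv, this]
  · rfl

theorem ev_setv (f : V → Γ) (k : C → Γ) (v : V) (b : Bool) (y : Γ) (l : List (Lt V C))
    (h : Avoid v l) : ev (setv f v b y) k l = ev f k l := by
  unfold ev
  congr 1
  apply List.map_congr_left
  intro x hx
  apply gv_setv_ne
  rintro b rfl
  exact h b hx

end values

/-! Reductions. -/
section red
variable {V C : Type}

/-- planar phase -/
inductive RU : List (Lt V C) → List (List C) → List C → Prop
  | base (c0 : List C) : RU (c0.map Sum.inr) [] c0
  | step (D1 D2 : List (Lt V C)) (A : List C) (v : V) (b : Bool) (Cs : List (List C)) (c0 : List C)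
      (hp : NoPair D1) (h1 : Avoid v D1) (h2 : Avoid v D2) (h : RU (D1 ++ D2) Cs c0) :
      RU (D1 ++ Sum.inl (v, b) :: (A.map Sum.inr ++ Sum.inl (v, !b) :: D2)) (A :: Cs) c0

/-- handle phase -/
inductive RH : List (Lt V C) → ℕ → List (List C) → List C → Prop
  | base (Q) (Cs) (c0) (h : RU Q Cs c0) : RH Q 0 Cs c0
  | step (D1 A B E D2 : List (Lt V C)) (v u : V) (b b' : Bool) (g : ℕ) (Cs) (c0)
      (huv : u ≠ v) (h1 : Avoid v (D1 ++ (E ++ (B ++ (A ++ D2)))))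
      (h2 : Avoid u (D1 ++ (E ++ (B ++ (A ++ D2)))))
      (h : RH (D1 ++ (E ++ (B ++ (A ++ D2)))) g Cs c0) :
      RH (D1 ++ Sum.inl (v, b) :: (A ++ Sum.inl (u, b') :: (B ++ Sum.inl (v, !b) ::
        (E ++ Sum.inl (u, !b') :: D2)))) (g + 1) Cs c0

def NoLink (Q : List (Lt V C)) : Prop := ∀ v b u b',
  ¬ List.Sublist [Sum.inl (v, b), Sum.inl (u, b'), Sum.inl (v, !b), Sum.inl (u, !b')] Q

theorem first_close (Q : List (Lt V C)) (h : ¬ NoPair Q) :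
    ∃ D x D2, Q = D ++ x :: D2 ∧ NoPair D ∧ ¬ NoPair (D ++ [x]) := by
  induction Q using List.reverseRecOn with
  | nil => exact absurd (by simp [NoPair]) h
  | append_singleton l x ih =>
    by_cases hl : NoPair l
    · exact ⟨l, x, [], rfl, hl, h⟩
    · obtain ⟨D, y, D2, rfl, h1, h2⟩ := ih hl
      exact ⟨D, y, D2 ++ [x], by simp, h1, h2⟩

theorem eq_map_inr (l : List (Lt V C)) (h : ∀ e, Sum.inl e ∉ l) :
    ∃ A : List C, l = A.map Sum.inr := by
  induction l with
  | nil => exact ⟨[], rfl⟩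
  | cons x l ih =>
    obtain ⟨A, rfl⟩ := ih (fun e he => h e (List.mem_cons_of_mem _ he))
    rcases x with e | a
    · exact absurd (List.mem_cons_self) (h e)
    · exact ⟨a :: A, rfl⟩

theorem quad_remove {v : V} {b : Bool} {P R S : List (Lt V C)}
    (h : Quad (P ++ Sum.inl (v, b) :: (R ++ Sum.inl (v, !b) :: S)))
    (h1 : Avoid v P) (h2 : Avoid v R) (h3 : Avoid v S) (T : List (Lt V C))
    (hT : T.Perm (P ++ (R ++ S))) : Quad T := by
  have hs : List.Sublist (P ++ (R ++ S)) (P ++ Sum.inl (v, b) :: (R ++ Sum.inl (v, !b) :: S)) :=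
    (List.Sublist.refl P).append (((List.Sublist.refl R).append
      (List.sublist_cons_self _ S)).trans (List.sublist_cons_self _ _))
  refine ⟨hT.nodup_iff.2 (hs.nodup h.1), ?_⟩
  intro u b' hu
  rw [hT.mem_iff] at hu ⊢
  have hu' := h.2 u b' (hs.subset hu)
  have huv : u ≠ v := by
    rintro rfl
    simp only [List.mem_append] at hu
    rcases hu with hu | hu | hu
    exacts [h1 _ hu, h2 _ hu, h3 _ hu]
  simpa [huv] using hu'

theorem perm_ABE {α : Type} (A B E D : List α) :
    (E ++ (B ++ (A ++ D))).Perm (A ++ (B ++ (E ++ D))) := by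
  classical
  rw [List.perm_iff_count]
  intro x
  simp only [List.count_append]; omega

theorem exists_RU (n : ℕ) : ∀ (Q : List (Lt V C)), Q.length ≤ n → Quad Q → NoLink Q →
    ∃ Cs c0, RU Q Cs c0 := by
  classical
  induction n with
  | zero =>
    intro Q hn _ _
    have : Q = [] := List.length_eq_zero_iff.1 (by omega)
    subst this
    exact ⟨[], [], RU.base []⟩
  | succ n ih =>
    intro Q hn hq hl
    by_cases hp : NoPair Q
    · obtain ⟨A, rfl⟩ := eq_map_inr Q (fun e he => hp e.1 e.2 he (hq.2 e.1 e.2 he))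
      exact ⟨_, _, RU.base A⟩
    · obtain ⟨D, x, D2, rfl, h1, h2⟩ := first_close Q hp
      have hx : ∃ v b, x = Sum.inl (v, !b) ∧ Sum.inl (v, b) ∈ D := by
        unfold NoPair at h2
        push Not at h2
        obtain ⟨v, b, h3, h4⟩ := h2
        simp only [List.mem_append, List.mem_singleton] at h3 h4
        rcases h3 with h3 | h3
        · rcases h4 with h4 | h4
          · exact absurd h4 (h1 _ _ h3)
          · exact ⟨v, b, h4.symm, h3⟩
        · rcases h4 with h4 | h4
          · exact ⟨v, !b, by simp [h3], h4⟩
          · subst h3; simp at h4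
      obtain ⟨v, b, rfl, hv⟩ := hx
      obtain ⟨D1, A', rfl⟩ := List.append_of_mem hv
      have hn' := hq.1
      have hA : ∀ e, Sum.inl e ∉ A' := by
        rintro ⟨u, b'⟩ hu
        have h5 := h1 u b' (by simp [hu])
        have h6 := hq.2 u b' (by simp [hu])
        have h7 : (Sum.inl (u, !b') : Lt V C) ∈ D2 := by
          rw [List.mem_append] at h6
          rcases h6 with h6 | h6
          · exact absurd h6 h5
          · rcases List.mem_cons.1 h6 with h6 | h6
            · exfalso
              simp only [Sum.inl.injEq, Prod.mk.injEq] at h6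
              obtain ⟨rfl, h6⟩ := h6
              have : b' = b := by cases b <;> cases b' <;> simp_all
              subst this
              simp only [List.nodup_append, List.nodup_cons] at hn'
              exact hn'.1.2.1.1 hu
            · exact h6
        apply hl v b u b'
        have e : ([Sum.inl (v, b), Sum.inl (u, b'), Sum.inl (v, !b), Sum.inl (u, !b')] : List (Lt V C))
          = ([Sum.inl (v, b), Sum.inl (u, b')] ++ [Sum.inl (v, !b), Sum.inl (u, !b')]) := rfl
        rw [e]
        apply List.Sublist.append
        · exact ((List.singleton_sublist.2 hu).cons_cons _).trans (List.sublist_append_right _ _)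
        · exact (List.singleton_sublist.2 h7).cons_cons _
      obtain ⟨A, rfl⟩ := eq_map_inr A' hA
      have e : D1 ++ Sum.inl (v, b) :: A.map Sum.inr ++ Sum.inl (v, !b) :: D2
        = D1 ++ Sum.inl (v, b) :: (A.map Sum.inr ++ Sum.inl (v, !b) :: D2) := by simp
      rw [e] at hq hn hl hn' ⊢
      have av1 : Avoid v D1 := by
        intro b1 hb1
        simp only [List.nodup_append, List.nodup_cons, List.mem_append, List.mem_cons] at hn'
        rcases Bool.eq_or_eq_not b1 b with rfl | rfl <;> grind
      have av2 : Avoid v D2 := by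
        intro b1 hb1
        simp only [List.nodup_append, List.nodup_cons, List.mem_append, List.mem_cons] at hn'
        rcases Bool.eq_or_eq_not b1 b with rfl | rfl <;> grind
      have hs : List.Sublist (D1 ++ D2) (D1 ++ Sum.inl (v, b) :: (A.map Sum.inr ++ Sum.inl (v, !b) :: D2)) :=
        (List.Sublist.refl D1).append (((List.sublist_cons_self _ D2).trans
          (List.sublist_append_right _ _)).trans (List.sublist_cons_self _ _))
      have hs' : List.Sublist (D1 ++ (A.map Sum.inr ++ D2)) (D1 ++ Sum.inl (v, b) :: (A.map Sum.inr ++ Sum.inl (v, !b) :: D2)) :=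
        (List.Sublist.refl D1).append (((List.Sublist.refl _).append
          (List.sublist_cons_self _ D2)).trans (List.sublist_cons_self _ _))
      have q2 : Quad (D1 ++ D2) := by
        refine ⟨hs.nodup hq.1, ?_⟩
        intro u b' hu
        have huv : u ≠ v := by
          rintro rfl
          rcases List.mem_append.1 hu with hu | hu
          exacts [av1 _ hu, av2 _ hu]
        have := hq.2 u b' (hs.subset hu)
        simpa [huv] using this
      obtain ⟨Cs, c0, hR⟩ := ih (D1 ++ D2) (by simp at hn ⊢; omega) q2
        (fun v b u b' h => hl v b u b' (h.trans hs))
      refine ⟨A :: Cs, c0, RU.step D1 D2 A v b Cs c0 ?_ av1 av2 hR⟩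
      intro w bw h3 h4
      exact h1 w bw (by simp [h3]) (by simp [h4])

theorem exists_RH (n : ℕ) : ∀ (Q : List (Lt V C)), Q.length ≤ n → Quad Q →
    ∃ g Cs c0, RH Q g Cs c0 := by
  classical
  induction n with
  | zero =>
    intro Q hn hq
    have : Q = [] := List.length_eq_zero_iff.1 (by omega)
    subst this
    exact ⟨0, [], [], RH.base _ _ _ (RU.base [])⟩
  | succ n ih =>
    intro Q hn hq
    by_cases hl : NoLink Q
    · obtain ⟨Cs, c0, h⟩ := exists_RU _ Q le_rfl hq hl
      exact ⟨0, Cs, c0, RH.base _ _ _ h⟩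
    · unfold NoLink at hl
      push Not at hl
      obtain ⟨v, b, u, b', hl⟩ := hl
      obtain ⟨r1, r2, rfl, m1, hl⟩ := List.cons_sublist_iff.1 hl
      obtain ⟨r3, r4, rfl, m2, hl⟩ := List.cons_sublist_iff.1 hl
      obtain ⟨r5, r6, rfl, m3, hl⟩ := List.cons_sublist_iff.1 hl
      have m4 := List.singleton_sublist.1 hl
      obtain ⟨D1, A1, rfl⟩ := List.append_of_mem m1
      obtain ⟨A2, B1, rfl⟩ := List.append_of_mem m2
      obtain ⟨B2, E1, rfl⟩ := List.append_of_mem m3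
      obtain ⟨E2, D2, rfl⟩ := List.append_of_mem m4
      have e : D1 ++ Sum.inl (v, b) :: A1 ++ (A2 ++ Sum.inl (u, b') :: B1 ++ (B2 ++ Sum.inl (v, !b) :: E1 ++ (E2 ++ Sum.inl (u, !b') :: D2)))
        = D1 ++ Sum.inl (v, b) :: ((A1 ++ A2) ++ Sum.inl (u, b') :: ((B1 ++ B2) ++ Sum.inl (v, !b) ::
        ((E1 ++ E2) ++ Sum.inl (u, !b') :: D2))) := by simp
      rw [e] at hq hn ⊢
      generalize A1 ++ A2 = A at *
      generalize B1 ++ B2 = B at *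
      generalize E1 ++ E2 = E at *
      clear e m1 m2 m3 m4 hl
      have hn' := hq.1
      simp only [List.nodup_append, List.nodup_cons, List.mem_append, List.mem_cons, not_or] at hn'
      have huv : u ≠ v := by
        rintro rfl
        rcases Bool.eq_or_eq_not b' b with rfl | rfl <;> grind
      have h1 : Avoid v (D1 ++ (E ++ (B ++ (A ++ D2)))) := by
        intro b1 hb1
        simp only [List.mem_append] at hb1
        rcases Bool.eq_or_eq_not b1 b with rfl | rfl <;> grind
      have h2 : Avoid u (D1 ++ (E ++ (B ++ (A ++ D2)))) := by
        intro b1 hb1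
        simp only [List.mem_append] at hb1
        rcases Bool.eq_or_eq_not b1 b' with rfl | rfl <;> grind
      have hsub : List.Sublist (D1 ++ (A ++ (B ++ (E ++ D2)))) (D1 ++ Sum.inl (v, b) :: (A ++ Sum.inl (u, b') :: (B ++ Sum.inl (v, !b) ::
        (E ++ Sum.inl (u, !b') :: D2)))) :=
        (List.Sublist.refl _).append (((List.Sublist.refl _).append (((List.Sublist.refl _).append
          (((List.Sublist.refl _).append (List.sublist_cons_self _ _)).trans
          (List.sublist_cons_self _ _))).trans (List.sublist_cons_self _ _))).trans
          (List.sublist_cons_self _ _))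
      have hperm : (D1 ++ (E ++ (B ++ (A ++ D2)))).Perm (D1 ++ (A ++ (B ++ (E ++ D2)))) := by
        apply List.Perm.append_left
        exact perm_ABE _ _ _ _
      have q2 : Quad (D1 ++ (E ++ (B ++ (A ++ D2)))) := by
        refine ⟨hperm.nodup_iff.2 (hsub.nodup hq.1), ?_⟩
        intro w bw hw
        have w1 : w ≠ v := by rintro rfl; exact h1 _ hw
        have w2 : w ≠ u := by rintro rfl; exact h2 _ hw
        have := hq.2 w bw (hsub.subset (hperm.mem_iff.1 hw))
        simp [w1, w2] at this ⊢
        tauto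
      obtain ⟨g, Cs, c0, hR⟩ := ih _ (by simp at hn ⊢; omega) q2
      exact ⟨g + 1, Cs, c0, RH.step D1 A B E D2 v u b b' g Cs c0 huv h1 h2 hR⟩

/-- coefficient letters of a word -/
def co (l : List (Lt V C)) : List C := l.filterMap Sum.getRight?

@[simp] theorem co_nil : co ([] : List (Lt V C)) = [] := rfl
@[simp] theorem co_append (l l' : List (Lt V C)) : co (l ++ l') = co l ++ co l' := by simp [co]
@[simp] theorem co_cons_inl (e : V × Bool) (l : List (Lt V C)) : co (Sum.inl e :: l) = co l := rfl
@[simp] theorem co_cons_inr (a : C) (l : List (Lt V C)) : co (Sum.inr a :: l) = a :: co l := rfl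
@[simp] theorem co_map_inr (l : List C) : co (l.map Sum.inr : List (Lt V C)) = l := by
  induction l with
  | nil => rfl
  | cons a l ih => simp [ih]

theorem RU.perm {Q : List (Lt V C)} {Cs c0} (h : RU Q Cs c0) :
    (co Q).Perm (Cs.flatten ++ c0) ∧ Q.length = 2 * Cs.length + (co Q).length := by
  induction h with
  | base c0 => simp
  | step D1 D2 A v b Cs c0 hp h1 h2 h ih =>
    obtain ⟨i1, i2⟩ := ih
    constructor
    · simp only [co_append, co_cons_inl, co_map_inr, List.flatten_cons] at i1 ⊢
      rw [← List.append_assoc, List.append_assoc A]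
      exact (List.perm_append_comm.append_right _).trans
        ((by rw [List.append_assoc]; exact i1.append_left A))
    · simp at i2 ⊢; omega

theorem RH.perm {Q : List (Lt V C)} {g Cs c0} (h : RH Q g Cs c0) :
    (co Q).Perm (Cs.flatten ++ c0) ∧ Q.length = 4 * g + 2 * Cs.length + (co Q).length := by
  induction h with
  | base Q Cs c0 h => simpa using h.perm
  | step D1 A B E D2 v u b b' g Cs c0 huv h1 h2 h ih =>
    obtain ⟨i1, i2⟩ := ih
    constructor
    · refine List.Perm.trans ?_ i1
      simp only [co_append, co_cons_inl]
      apply List.Perm.append_left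
      exact perm_ABE _ _ _ _ |>.symm
    · simp at i2 ⊢; omega

end red

set_option linter.unusedSectionVars false
section matr
open Matrix
variable {V C K : Type} [Fintype V] [DecidableEq V] [Fintype K] [DecidableEq K]

/-- the matrix of a letter, for a state `f` -/
def mv (X : C → Matrix K K ℚ) (f : V → K × K) : Lt V C → Matrix K K ℚ
  | Sum.inl (v, true) => Matrix.single (f v).1 (f v).2 1
  | Sum.inl (v, false) => Matrix.single (f v).2 (f v).1 1
  | Sum.inr a => X a

def mp (X : C → Matrix K K ℚ) (f : V → K × K) (l : List (Lt V C)) : Matrix K K ℚ :=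
  (l.map (mv X f)).prod

def cm (X : C → Matrix K K ℚ) (l : List C) : Matrix K K ℚ := (l.map X).prod

def MM (X : C → Matrix K K ℚ) (l : List (Lt V C)) : ℚ := ∑ f : V → K × K, (mp X f l).trace

@[simp] theorem mp_nil (X : C → Matrix K K ℚ) (f : V → K × K) : mp X f [] = 1 := rfl
@[simp] theorem mp_cons (X : C → Matrix K K ℚ) (f : V → K × K) (x l) :
    mp X f (x :: l) = mv X f x * mp X f l := by simp [mp]
@[simp] theorem mp_append (X : C → Matrix K K ℚ) (f : V → K × K) (l l') :
    mp X f (l ++ l') = mp X f l * mp X f l' := by simp [mp]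
@[simp] theorem mp_map_inr (X : C → Matrix K K ℚ) (f : V → K × K) (l : List C) :
    mp X f (l.map Sum.inr) = cm X l := by
  simp [mp, cm, Function.comp_def, mv]

theorem mp_update (X : C → Matrix K K ℚ) (f : V → K × K) (v : V) (e : K × K) (l : List (Lt V C))
    (h : Avoid v l) : mp X (Function.update f v e) l = mp X f l := by
  unfold mp
  congr 1
  apply List.map_congr_left
  rintro (⟨u, b⟩ | a) hx
  · have : u ≠ v := by rintro rfl; exact h b hx
    cases b <;> simp [mv, this]
  · rfl

theorem sum_update {β : Type} [Fintype β] (v : V) (F : (V → β) → ℚ) :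
    ∑ f : V → β, ∑ e : β, F (Function.update f v e) = Fintype.card β * ∑ f : V → β, F f := by
  rw [← Fintype.sum_prod_type' (f := fun f e => F (Function.update f v e))]
  rw [Fintype.sum_equiv (⟨fun p => (Function.update p.1 v p.2, p.1 v),
    fun p => (Function.update p.1 v p.2, p.1 v), fun p => by simp, fun p => by simp⟩ :
      (V → β) × β ≃ (V → β) × β) (fun p => F (Function.update p.1 v p.2)) (fun p => F p.1)
      (fun p => rfl)]
  rw [Fintype.sum_prod_type]
  simp [Finset.mul_sum]

theorem trace_mul_single' (Y : Matrix K K ℚ) (i j : K) : (Y * Matrix.single i j 1).trace = Y j i := by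
  rw [Matrix.trace_mul_comm]
  simp [Matrix.trace, Matrix.mul_apply, Matrix.single_apply, ite_and]

theorem sum_pair (R S P : Matrix K K ℚ) :
    ∑ e : K × K, (P * (Matrix.single e.1 e.2 1 * (R * (Matrix.single e.2 e.1 1 * S)))).trace
      = R.trace * (S * P).trace := by
  have : ∀ e : K × K, (P * (Matrix.single e.1 e.2 1 * (R * (Matrix.single e.2 e.1 1 * S)))).trace
      = R e.2 e.2 * (S * P) e.1 e.1 := by
    intro e
    have h1 : (Matrix.single e.1 e.2 1 * (R * Matrix.single e.2 e.1 (1:ℚ)))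
        = R e.2 e.2 • Matrix.single e.1 e.1 1 := by
      rw [← Matrix.mul_assoc]
      simp [Matrix.single_mul_mul_single, Matrix.smul_single]
    rw [Matrix.trace_mul_comm, ← Matrix.mul_assoc R, ← Matrix.mul_assoc, Matrix.mul_assoc,
      Matrix.trace_mul_comm, h1, Matrix.mul_smul, Matrix.trace_smul, trace_mul_single', smul_eq_mul]
  simp_rw [this]
  rw [Fintype.sum_prod_type, Finset.sum_comm]
  simp only [Matrix.trace, Matrix.diag]
  rw [Finset.sum_mul_sum]

theorem sum_link (Y Z : Matrix K K ℚ) :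
    ∑ e : K × K, (Y * Matrix.single e.1 e.2 1).trace * (Z * Matrix.single e.2 e.1 1).trace
      = (Y * Z).trace := by
  simp_rw [trace_mul_single']
  rw [Fintype.sum_prod_type, Finset.sum_comm]
  simp only [Matrix.trace, Matrix.diag, Matrix.mul_apply]

/-- both signs -/
theorem sum_pair_mv (X : C → Matrix K K ℚ) (f : V → K × K) (v : V) (b : Bool) (R S P : Matrix K K ℚ) :
    ∑ e : K × K, (P * (mv X (Function.update f v e) (Sum.inl (v, b)) *
      (R * (mv X (Function.update f v e) (Sum.inl (v, !b)) * S)))).trace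
      = R.trace * (S * P).trace := by
  cases b
  · rw [← sum_pair, ← (Equiv.prodComm K K).sum_comp]
    simp [mv]
  · rw [← sum_pair]
    simp [mv]

theorem sum_link_mv (X : C → Matrix K K ℚ) (f : V → K × K) (v : V) (b : Bool) (Y Z : Matrix K K ℚ) :
    ∑ e : K × K, (Y * mv X (Function.update f v e) (Sum.inl (v, b))).trace *
      (Z * mv X (Function.update f v e) (Sum.inl (v, !b))).trace
      = (Y * Z).trace := by
  cases b
  · rw [← sum_link, ← (Equiv.prodComm K K).sum_comp]
    simp [mv]
  · rw [← sum_link]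
    simp [mv]

def MT (X : C → Matrix K K ℚ) (l l' : List (Lt V C)) : ℚ :=
  ∑ f : V → K × K, (mp X f l).trace * (mp X f l').trace

theorem MM_pair (X : C → Matrix K K ℚ) (P R S : List (Lt V C)) (v : V) (b : Bool)
    (h1 : Avoid v P) (h2 : Avoid v R) (h3 : Avoid v S) :
    (Fintype.card (K × K) : ℚ) * MM X (P ++ Sum.inl (v, b) :: (R ++ Sum.inl (v, !b) :: S))
      = MT X R (S ++ P) := by
  unfold MM MT
  rw [← sum_update v]
  refine Finset.sum_congr rfl fun f _ => ?_
  simp only [mp_append, mp_cons, mp_update X f v _ _ h1, mp_update X f v _ _ h2,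
    mp_update X f v _ _ h3]
  rw [sum_pair_mv]

theorem MT_link (X : C → Matrix K K ℚ) (A B E D : List (Lt V C)) (v : V) (b : Bool)
    (h1 : Avoid v A) (h2 : Avoid v B) (h3 : Avoid v E) (h4 : Avoid v D) :
    (Fintype.card (K × K) : ℚ) * MT X (A ++ Sum.inl (v, b) :: B) (E ++ Sum.inl (v, !b) :: D)
      = MM X (B ++ (A ++ (D ++ E))) := by
  unfold MM MT
  rw [← sum_update v]
  refine Finset.sum_congr rfl fun f _ => ?_
  simp only [mp_append, mp_cons, mp_update X f v _ _ h1, mp_update X f v _ _ h2,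
    mp_update X f v _ _ h3, mp_update X f v _ _ h4]
  rw [← Matrix.mul_assoc (mp X f B), ← sum_link_mv X f v b]
  refine Finset.sum_congr rfl fun e _ => ?_
  rw [Matrix.trace_mul_comm (mp X f A), Matrix.trace_mul_comm (mp X f E), Matrix.mul_assoc,
    Matrix.mul_assoc, Matrix.trace_mul_comm (mv _ _ _), Matrix.trace_mul_comm (mv _ _ _)]

theorem MT_pair (X : C → Matrix K K ℚ) (P R S Y : List (Lt V C)) (v : V) (b : Bool)
    (h1 : Avoid v P) (h2 : Avoid v R) (h3 : Avoid v S) (h4 : Avoid v Y) :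
    (Fintype.card (K × K) : ℚ) * MT X (P ++ Sum.inl (v, b) :: (R ++ Sum.inl (v, !b) :: S)) Y
      = ∑ f : V → K × K, (mp X f R).trace * (mp X f (S ++ P)).trace * (mp X f Y).trace := by
  unfold MT
  rw [← sum_update v]
  refine Finset.sum_congr rfl fun f _ => ?_
  simp only [mp_append, mp_cons, mp_update X f v _ _ h1, mp_update X f v _ _ h2,
    mp_update X f v _ _ h3, mp_update X f v _ _ h4]
  rw [← Finset.sum_mul, sum_pair_mv]

theorem MM_rot (X : C → Matrix K K ℚ) (P R : List (Lt V C)) : MM X (P ++ R) = MM X (R ++ P) := by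
  unfold MM
  refine Finset.sum_congr rfl fun f _ => ?_
  rw [mp_append, mp_append, Matrix.trace_mul_comm]

theorem MT_rot_left (X : C → Matrix K K ℚ) (P R Y : List (Lt V C)) :
    MT X (P ++ R) Y = MT X (R ++ P) Y := by
  unfold MT
  refine Finset.sum_congr rfl fun f _ => ?_
  rw [mp_append, mp_append, Matrix.trace_mul_comm]

theorem MT_rot_right (X : C → Matrix K K ℚ) (P R Y : List (Lt V C)) :
    MT X Y (P ++ R) = MT X Y (R ++ P) := by
  unfold MT
  refine Finset.sum_congr rfl fun f _ => ?_
  rw [mp_append, mp_append, Matrix.trace_mul_comm]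

theorem MM_handle (X : C → Matrix K K ℚ) (D1 A B E D2 : List (Lt V C)) (v u : V) (b b' : Bool)
    (huv : u ≠ v) (h1 : Avoid v (D1 ++ (E ++ (B ++ (A ++ D2)))))
    (h2 : Avoid u (D1 ++ (E ++ (B ++ (A ++ D2))))) :
    (Fintype.card (K × K) : ℚ) ^ 2 * MM X (D1 ++ Sum.inl (v, b) :: (A ++ Sum.inl (u, b') :: (B ++ Sum.inl (v, !b) ::
        (E ++ Sum.inl (u, !b') :: D2)))) = MM X (D1 ++ (E ++ (B ++ (A ++ D2)))) := by
  simp only [avoid_append] at h1 h2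
  have e : D1 ++ Sum.inl (v, b) :: (A ++ Sum.inl (u, b') :: (B ++ Sum.inl (v, !b) ::
        (E ++ Sum.inl (u, !b') :: D2))) = D1 ++ Sum.inl (v, b) :: ((A ++ Sum.inl (u, b') :: B) ++ Sum.inl (v, !b) ::
        (E ++ Sum.inl (u, !b') :: D2)) := by simp
  rw [e, pow_two, mul_assoc, MM_pair X D1 _ _ v b h1.1 (by simp [huv.symm, h1]) (by simp [huv.symm, h1])]
  rw [List.append_assoc, List.cons_append, MT_link X A B E (D2 ++ D1) u b' h2.2.2.2.1 h2.2.2.1 h2.2.1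
    (by simp [h2])]
  have := MM_rot X (D1 ++ E) (B ++ (A ++ D2))
  simpa only [List.append_assoc] using this.symm

theorem MM_slide (X : C → Matrix K K ℚ) (D1 D2 D3 w1 w2 : List (Lt V C)) (v : V) (b : Bool)
    (h : Avoid v (D1 ++ (D2 ++ (D3 ++ (w1 ++ w2))))) [Nonempty K] :
    MM X (D1 ++ (w1 ++ Sum.inl (v, b) :: (w2 ++ (D2 ++ Sum.inl (v, !b) :: D3))))
      = MM X (D1 ++ Sum.inl (v, b) :: (D2 ++ (w2 ++ Sum.inl (v, !b) :: (w1 ++ D3)))) := by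
  simp only [avoid_append] at h
  have hK : (Fintype.card (K × K) : ℚ) ≠ 0 := by
    exact_mod_cast Fintype.card_ne_zero
  apply mul_left_cancel₀ hK
  rw [← List.append_assoc D1, ← List.append_assoc w2,
    MM_pair X (D1 ++ w1) (w2 ++ D2) D3 v b (by simp [h]) (by simp [h]) (by simp [h]),
    ← List.append_assoc D2, MM_pair X D1 (D2 ++ w2) (w1 ++ D3) v b (by simp [h]) (by simp [h]) (by simp [h]),
    MT_rot_left, ← List.append_assoc, MT_rot_right X _ w1]
  simp

theorem MM_slide' (X : C → Matrix K K ℚ) (D1 D2 D3 w1 w2 : List (Lt V C)) (v : V) (b : Bool)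
    (h : Avoid v (D1 ++ (D2 ++ (D3 ++ (w1 ++ w2))))) [Nonempty K] :
    MM X (D1 ++ Sum.inl (v, b) :: (D2 ++ (w1 ++ Sum.inl (v, !b) :: (w2 ++ D3))))
      = MM X (D1 ++ (w2 ++ Sum.inl (v, b) :: (w1 ++ (D2 ++ Sum.inl (v, !b) :: D3)))) := by
  have := MM_slide X D1 D2 D3 w2 w1 v b (by simp at h ⊢; tauto)
  exact this.symm

theorem RU.MM {Q : List (Lt V C)} {Cs c0} (h : RU Q Cs c0) (X : C → Matrix K K ℚ) :
    (Fintype.card (K × K) : ℚ) ^ Cs.length * MM X Q = (Fintype.card (K × K) : ℚ) ^ (Fintype.card V)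
      * ((Cs.map fun l => (cm X l).trace).prod * (cm X c0).trace) := by
  induction h with
  | base c0 => simp [Stmt0.MM]
  | step D1 D2 A v b Cs c0 hp h1 h2 h ih =>
    rw [List.length_cons, pow_succ, mul_assoc, MM_pair X D1 _ D2 v b h1 (by simp) h2]
    have : MT X (A.map Sum.inr) (D2 ++ D1) = (cm X A).trace * Stmt0.MM X (D1 ++ D2) := by
      rw [MM_rot]
      unfold MT Stmt0.MM
      simp [Finset.mul_sum]
    rw [this, mul_left_comm, ih]
    simp only [List.map_cons, List.prod_cons]
    ring

theorem RH.MM {Q : List (Lt V C)} {g Cs c0} (h : RH Q g Cs c0) (X : C → Matrix K K ℚ) :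
    (Fintype.card (K × K) : ℚ) ^ (2 * g + Cs.length) * MM X Q = (Fintype.card (K × K) : ℚ) ^ (Fintype.card V)
      * ((Cs.map fun l => (cm X l).trace).prod * (cm X c0).trace) := by
  induction h with
  | base Q Cs c0 h => simpa using h.MM X
  | step D1 A B E D2 v u b b' g Cs c0 huv h1 h2 h ih =>
    rw [← ih, ← MM_handle X D1 A B E D2 v u b b' huv h1 h2]
    ring

end matr

section sim
open Matrix

/-- similarity of words: same matrix invariants up to normalisation -/
def Sim {V V' C : Type} [Fintype V] [DecidableEq V] [Fintype V'] [DecidableEq V']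
    (Q : List (Lt V C)) (Q' : List (Lt V' C)) : Prop :=
  ∀ (K : Type) [Fintype K] [DecidableEq K] [Nonempty K] (X : C → Matrix K K ℚ),
    MM X Q' * (Fintype.card K : ℚ) ^ (Fintype.card V)
      = MM X Q * (Fintype.card K : ℚ) ^ (Fintype.card V')

variable {V V' V'' C : Type} [Fintype V] [DecidableEq V] [Fintype V'] [DecidableEq V']
   [Fintype V''] [DecidableEq V'']

theorem Sim.refl (Q : List (Lt V C)) : Sim Q Q := fun _ _ _ _ _ => rfl

theorem Sim.trans {Q : List (Lt V C)} {Q' : List (Lt V' C)} {Q'' : List (Lt V'' C)}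
    (h : Sim Q Q') (h' : Sim Q' Q'') : Sim Q Q'' := by
  intro K _ _ _ X
  have h1 := h K X
  have h2 := h' K X
  have hK : (Fintype.card K : ℚ) ^ (Fintype.card V') ≠ 0 :=
    pow_ne_zero _ (by exact_mod_cast Fintype.card_ne_zero)
  apply mul_right_cancel₀ hK
  rw [mul_right_comm, h2, mul_right_comm, h1]
  ring

/-- letters of `V` in `Option V` -/
def sb : Lt V C → Lt (Option V) C := Sum.map (Prod.map some id) id

theorem sim_subdiv (P R S : List (Lt V C)) (v : V) (b : Bool)
    (h1 : Avoid v P) (h2 : Avoid v R) (h3 : Avoid v S) :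
    Sim (P ++ Sum.inl (v, b) :: (R ++ Sum.inl (v, !b) :: S))
      (P.map sb ++ Sum.inl (some v, b) :: (Sum.inl (none, b) :: R.map sb ++ Sum.inl (none, !b) ::
        Sum.inl (some v, !b) :: S.map sb)) := by
  intro K _ _ _ X
  have a1 : ∀ l : List (Lt V C), Avoid v l → Avoid (some v) (l.map sb) := by
    intro l hl b hb
    rw [List.mem_map] at hb
    obtain ⟨⟨u, b'⟩ | a, h, e⟩ := hb
    · simp [sb] at e
      obtain ⟨rfl, rfl⟩ := e
      exact hl _ h
    · simp [sb] at e
  have a2 : ∀ l : List (Lt V C), Avoid none (l.map sb) := by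
    intro l b hb
    rw [List.mem_map] at hb
    obtain ⟨⟨u, b'⟩ | a, h, e⟩ := hb <;> simp [sb] at e
  have a3 : ∀ (f : Option V → K × K) (l : List (Lt V C)), mp X f (l.map sb) = mp X (f ∘ some) l := by
    intro f l
    simp only [mp, List.map_map]
    congr 1
    apply List.map_congr_left
    rintro (⟨u, _ | _⟩ | a) hx <;> rfl
  have e0 := MM_pair X P R S v b h1 h2 h3
  have e1 := MM_pair X (P.map sb) (Sum.inl (none, b) :: R.map sb ++ [Sum.inl (none, !b)]) (S.map sb) (some v) b
    (a1 _ h1) (by simp [a1 _ h2]) (a1 _ h3)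
  have e2 := MT_pair X [] (R.map sb) [] (S.map sb ++ P.map sb) none b (by simp) (a2 _) (by simp) (by simp [a2])
  simp only [List.nil_append, ← List.map_append, a3] at e2
  have e3 : ∑ f : Option V → K × K, (mp X (f ∘ some) R).trace * (mp X f ([] : List (Lt (Option V) C))).trace *
      (mp X (f ∘ some) (S ++ P)).trace = Fintype.card (K × K) * Fintype.card K * MT X R (S ++ P) := by
    rw [← (Equiv.piOptionEquivProd (β := fun _ : Option V => K × K)).symm.sum_comp, Fintype.sum_prod_type]
    have : ∀ (x : K × K) (y : V → K × K), ((Equiv.piOptionEquivProd (β := fun _ : Option V => K × K)).symm (x, y) ∘ some)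
      = y := by intro x y; rfl
    simp only [this, mp_nil, Matrix.trace_one, Finset.sum_const, Finset.card_univ, MT, nsmul_eq_mul, Finset.mul_sum]
    refine Finset.sum_congr rfl fun f _ => by ring
  rw [e3, ← e0] at e2
  simp only [List.map_append, List.cons_append] at e1 e2
  rw [← e1] at e2
  have hK' : (Fintype.card K : ℚ) ≠ 0 := by exact_mod_cast Fintype.card_ne_zero
  have hK : (Fintype.card (K × K) : ℚ) ≠ 0 := by exact_mod_cast Fintype.card_ne_zero
  rw [Fintype.card_option, pow_succ]
  simp only [List.append_assoc, List.cons_append, List.nil_append] at e2 ⊢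
  have e4 := mul_left_cancel₀ hK (e2.trans (by ring : _ = (Fintype.card (K × K) : ℚ) * (Fintype.card (K × K) *
    (Fintype.card K * MM X (P ++ Sum.inl (v, b) :: (R ++ Sum.inl (v, !b) :: S))))))
  rw [mul_left_cancel₀ hK e4]
  ring

end sim

set_option linter.unusedSectionVars false
section uniq
open Matrix
variable {C : Type} [Fintype C] [DecidableEq C]

def XX (κ : C → C) (a : C) : Matrix (C ⊕ Bool) (C ⊕ Bool) ℚ :=
  Matrix.single (Sum.inl a) (Sum.inl (κ a)) 1

def tc (κ : C → C) (l : List C) : ℚ := (cm (XX κ) l).trace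

theorem cm_XX (κ : C → C) (a : C) (t : List C) :
    (List.IsChain (fun a b => κ a = b) (a :: t) →
      cm (XX κ) (a :: t) = Matrix.single (Sum.inl a) (Sum.inl (κ ((a :: t).getLast (by simp)))) 1) ∧
    (¬ List.IsChain (fun a b => κ a = b) (a :: t) → cm (XX κ) (a :: t) = 0) := by
  induction t generalizing a with
  | nil => simp [cm, XX]
  | cons b t ih =>
    have e : cm (XX κ) (a :: b :: t) = XX κ a * cm (XX κ) (b :: t) := by simp [cm]
    rw [e, List.isChain_cons_cons]
    constructor
    · rintro ⟨rfl, h⟩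
      rw [(ih _).1 h, XX, Matrix.single_mul_single_same]
      simp
    · intro h
      by_cases h1 : List.IsChain (fun a b => κ a = b) (b :: t)
      · rw [(ih _).1 h1, XX, Matrix.single_mul_single_of_ne]
        intro h2
        exact h ⟨Sum.inl_injective h2, h1⟩
      · rw [(ih _).2 h1, Matrix.mul_zero]

theorem trace_single_inl (a b : C) : (Matrix.single (Sum.inl a : C ⊕ Bool) (Sum.inl b) (1:ℚ)).trace
    = if a = b then 1 else 0 := by
  by_cases h : a = b
  · subst h; simp
  · rw [if_neg h, Matrix.trace_single_eq_of_ne]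
    simpa using h

theorem tc_cons (κ : C → C) (a : C) (t : List C) :
    tc κ (a :: t) ≠ 0 ↔ List.IsChain (fun a b => κ a = b) (a :: t) ∧ κ ((a :: t).getLast (by simp)) = a := by
  unfold tc
  by_cases h : List.IsChain (fun a b => κ a = b) (a :: t)
  · rw [(cm_XX κ a t).1 h, trace_single_inl]
    simp only [h, true_and]
    constructor
    · intro h; by_contra h2; exact h (if_neg (Ne.symm h2))
    · intro h; rw [if_pos h.symm]; exact one_ne_zero
  · rw [(cm_XX κ a t).2 h]
    simp [h]

theorem tc_eq_one (κ : C → C) (l : List C) (hl : l ≠ []) (h : tc κ l ≠ 0) : tc κ l = 1 := by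
  obtain ⟨a, t, rfl⟩ := List.exists_cons_of_ne_nil hl
  have := (tc_cons κ a t).1 h
  unfold tc
  rw [(cm_XX κ a t).1 this.1, trace_single_inl, if_pos this.2.symm]

theorem tc_rot (κ : C → C) (l l' : List C) : tc κ (l ++ l') = tc κ (l' ++ l) := by
  unfold tc cm
  rw [List.map_append, List.prod_append, Matrix.trace_mul_comm]
  simp

theorem chain_det (κ : C → C) (a : C) : ∀ (t t' : List C) (b : C),
    List.IsChain (fun a b => κ a = b) (b :: t) → κ ((b :: t).getLast (by simp)) = a → a ∉ t →
    List.IsChain (fun a b => κ a = b) (b :: t') → κ ((b :: t').getLast (by simp)) = a → a ∉ t' →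
    t = t' := by
  intro t
  induction t with
  | nil =>
    intro t' b _ h2 _ h4 h5 h6
    rcases t' with _ | ⟨x, s⟩
    · rfl
    · rw [List.isChain_cons_cons] at h4
      simp only [List.getLast_singleton] at h2
      exact absurd (by simp [← h2, h4.1]) h6
  | cons x s ih =>
    intro t' b h1 h2 h3 h4 h5 h6
    rw [List.isChain_cons_cons] at h1
    rcases t' with _ | ⟨y, s'⟩
    · simp only [List.getLast_singleton] at h5
      exact absurd (by simp [← h5, h1.1]) h3
    · rw [List.isChain_cons_cons] at h4
      obtain rfl : x = y := h1.1.symm.trans h4.1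
      rw [ih s' x h1.2 (by simpa using h2) (by simp at h3; tauto) h4.2 (by simpa using h5) (by simp at h6; tauto)]

theorem rot_of_share (κ : C → C) (l l' : List C) (hn : l.Nodup) (hn' : l'.Nodup)
    (h : tc κ l ≠ 0) (h' : tc κ l' ≠ 0) (a : C) (ha : a ∈ l) (ha' : a ∈ l') : l ~r l' := by
  obtain ⟨p, s, rfl⟩ := List.append_of_mem ha
  obtain ⟨p', s', rfl⟩ := List.append_of_mem ha'
  rw [tc_rot, List.cons_append, tc_cons] at h h'
  have hn1 := List.nodup_append_comm.1 hn
  have hn1' := List.nodup_append_comm.1 hn'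
  rw [List.cons_append, List.nodup_cons] at hn1 hn1'
  have := chain_det κ a _ _ a h.1 h.2 hn1.1 h'.1 h'.2 hn1'.1
  have e : a :: s ++ p = a :: s' ++ p' := by simp [this]
  have r1 : (p ++ a :: s) ~r (a :: s ++ p) := List.isRotated_append
  have r2 : (p' ++ a :: s') ~r (a :: s' ++ p') := List.isRotated_append
  exact r1.trans (e ▸ r2.symm)

theorem tc_formPerm (l : List C) (hn : l.Nodup) (hl : l ≠ []) (κ : C → C) (hκ : ∀ a ∈ l, κ a = l.formPerm a) :
    tc κ l ≠ 0 := by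
  obtain ⟨a, t, rfl⟩ := List.exists_cons_of_ne_nil hl
  rw [tc_cons]
  constructor
  · rw [List.isChain_iff_getElem]
    intro i hi
    rw [hκ _ (List.getElem_mem _), List.formPerm_apply_getElem _ hn, ]
    congr 1
    exact Nat.mod_eq_of_lt hi
  · rw [hκ _ (List.getLast_mem _)]
    exact List.formPerm_apply_getLast _ _

theorem exists_kappa (L : List (List C)) (hn : L.flatten.Nodup) :
    ∃ κ : C → C, ∀ l ∈ L, l ≠ [] → tc κ l ≠ 0 := by
  have hn' := List.nodup_flatten.1 hn
  suffices ∃ κ : C → C, ∀ l ∈ L, ∀ a ∈ l, κ a = l.formPerm a by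
    obtain ⟨κ, h⟩ := this
    exact ⟨κ, fun l hl hne => tc_formPerm l (hn'.1 l hl) hne κ (h l hl)⟩
  clear hn'
  induction L with
  | nil => exact ⟨id, by simp⟩
  | cons l L ih =>
    rw [List.flatten_cons, List.nodup_append] at hn
    obtain ⟨κ, h⟩ := ih hn.2.1
    refine ⟨fun a => if a ∈ l then l.formPerm a else κ a, ?_⟩
    intro l' hl' a ha
    rcases List.mem_cons.1 hl' with rfl | hl'
    · simp [ha]
    · have : a ∉ l := fun h' => hn.2.2 a h' a (List.mem_flatten.2 ⟨l', hl', ha⟩) rfl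
      simp only [this, if_false]
      exact h l' hl' a ha

/-- nonempty circles -/
def ne (L : List (List C)) : List (List C) := L.filter (fun l => decide (l ≠ []))

theorem prod_tc (κ : C → C) (L : List (List C)) (h : ∀ l ∈ L, l ≠ [] → tc κ l ≠ 0) :
    (L.map (tc κ)).prod * (Fintype.card (C ⊕ Bool) : ℚ) ^ (ne L).length
      = (Fintype.card (C ⊕ Bool) : ℚ) ^ L.length := by
  induction L with
  | nil => simp [ne]
  | cons l L ih =>
    have := ih (fun l hl => h l (List.mem_cons_of_mem _ hl))
    by_cases hl : l = []
    · subst hl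
      have e : tc κ [] = (Fintype.card (C ⊕ Bool) : ℚ) := by simp [tc, cm]
      simp only [List.map_cons, List.prod_cons, e, List.length_cons, pow_succ, ← this]
      simp [ne]
      ring
    · rw [List.map_cons, List.prod_cons, tc_eq_one κ l hl (h l (by simp) hl)]
      simp only [ne, List.length_cons, pow_succ, ← this, decide_true, hl, ne_eq, not_false_eq_true,
        List.filter_cons_of_pos]
      ring

theorem ne_nodup (L : List (List C)) (hn : L.flatten.Nodup) :
    ((ne L).map (fun l : List C => (l : Cycle C))).Nodup := by
  have hn' := List.nodup_flatten.1 hn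
  unfold List.Nodup
  rw [List.pairwise_map]
  have h2 := hn'.2.filter (fun l => decide (l ≠ []))
  refine List.Pairwise.imp_of_mem ?_ h2
  intro a b ha hb hab e
  have ha' : a ≠ [] := by simpa using (List.mem_filter.1 ha).2
  obtain ⟨x, t, rfl⟩ := List.exists_cons_of_ne_nil ha'
  have := (Cycle.coe_eq_coe.1 e).mem_iff (a := x)
  exact hab (by simp) (this.1 (by simp))

variable {V V' : Type} [Fintype V] [DecidableEq V] [Fintype V'] [DecidableEq V']

theorem Full.length {Q : List (Lt V C)} (h : Full Q) : Q.length = 2 * Fintype.card V + Fintype.card C := by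
  have e1 : Q.toFinset = Finset.univ := by ext x; simp [h.2 x]
  rw [← List.toFinset_card_of_nodup h.1, e1, Finset.card_univ]
  simp; ring

theorem Full.co_nodup {Q : List (Lt V C)} (h : Full Q) : (co Q).Nodup := by
  apply h.1.filterMap
  rintro (e | a) (e' | a') b <;> simp <;> grind

theorem Full.mem_co {Q : List (Lt V C)} (h : Full Q) (a : C) : a ∈ co Q := by
  unfold co
  rw [List.mem_filterMap]
  exact ⟨Sum.inr a, h.2 _, rfl⟩

theorem Full.co_length {Q : List (Lt V C)} (h : Full Q) : (co Q).length = Fintype.card C := by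
  have e1 : (co Q).toFinset = Finset.univ := by ext x; simp [h.mem_co x]
  rw [← List.toFinset_card_of_nodup h.co_nodup, e1, Finset.card_univ]

theorem RH.card {Q : List (Lt V C)} {g Cs c0} (hf : Full Q) (h : RH Q g Cs c0) :
    Fintype.card V = 2 * g + Cs.length := by
  have h1 := hf.length
  have h2 := h.perm.2
  have h3 := hf.co_length
  omega

theorem RH.full {Q : List (Lt V C)} {g Cs c0} (hf : Full Q) (h : RH Q g Cs c0) :
    (Cs ++ [c0]).flatten.Nodup ∧ ∀ a, a ∈ (Cs ++ [c0]).flatten := by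
  have h2 := h.perm.1
  have e : (Cs ++ [c0]).flatten = Cs.flatten ++ c0 := by simp
  rw [e]
  exact ⟨h2.nodup_iff.1 hf.co_nodup, fun a => h2.mem_iff.1 (hf.mem_co a)⟩

theorem RH.MM_eq {Q : List (Lt V C)} {g Cs c0} (hf : Full Q) (h : RH Q g Cs c0) (κ : C → C) :
    Stmt0.MM (XX κ) Q = ((Cs ++ [c0]).map (tc κ)).prod := by
  have h1 := h.MM (XX κ)
  rw [h.card hf] at h1
  have hK : (Fintype.card ((C ⊕ Bool) × (C ⊕ Bool)) : ℚ) ^ (2 * g + Cs.length) ≠ 0 :=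
    pow_ne_zero _ (by exact_mod_cast Fintype.card_ne_zero)
  rw [mul_left_cancel₀ hK h1]
  simp only [List.map_append, List.prod_append, List.map_cons, List.map_nil, List.prod_singleton]
  rfl

theorem uniq {Q : List (Lt V C)} {Q' : List (Lt V' C)} {g Cs c0 g' Cs' c0'}
    (hf : Full Q) (h : RH Q g Cs c0) (hf' : Full Q') (h' : RH Q' g' Cs' c0') (hs : Sim Q Q') :
    g = g' ∧ ((ne (Cs ++ [c0])).map (fun l : List C => (l : Cycle C))).Perm
      ((ne (Cs' ++ [c0'])).map (fun l : List C => (l : Cycle C))) := by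
  obtain ⟨n1, f1⟩ := h.full hf
  obtain ⟨n2, f2⟩ := h'.full hf'
  obtain ⟨κ, hκ⟩ := exists_kappa _ n1
  have m1 := h.MM_eq hf κ
  have m2 := h'.MM_eq hf' κ
  have e := hs (C ⊕ Bool) (XX κ)
  have hK : (Fintype.card (C ⊕ Bool) : ℚ) ≠ 0 := by exact_mod_cast Fintype.card_ne_zero
  have p1 := prod_tc κ _ hκ
  rw [m1, m2] at e
  have z1 : ((Cs ++ [c0]).map (tc κ)).prod ≠ 0 := by
    intro h0; rw [h0, zero_mul] at p1
    exact pow_ne_zero _ hK p1.symm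
  have z2 : ((Cs' ++ [c0']).map (tc κ)).prod ≠ 0 := by
    intro h0; rw [h0, zero_mul] at e
    exact mul_ne_zero z1 (pow_ne_zero _ hK) e.symm
  have hκ' : ∀ l ∈ Cs' ++ [c0'], l ≠ [] → tc κ l ≠ 0 := by
    intro l hl _ h0
    exact z2 (List.prod_eq_zero (List.mem_map.2 ⟨l, hl, h0⟩))
  have p2 := prod_tc κ _ hκ'
  have k1 := List.nodup_flatten.1 n1
  have k2 := List.nodup_flatten.1 n2
  have key : ∀ (L L' : List (List C)), L.flatten.Nodup → L'.flatten.Nodup → (∀ a, a ∈ L'.flatten) →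
      (∀ l ∈ L, l ≠ [] → tc κ l ≠ 0) → (∀ l ∈ L', l ≠ [] → tc κ l ≠ 0) →
      ∀ c, c ∈ (ne L).map (fun l : List C => (l : Cycle C)) → c ∈ (ne L').map (fun l : List C => (l : Cycle C)) := by
    intro L L' n1 n2 f2 t1 t2 c hc
    obtain ⟨l, hl, rfl⟩ := List.mem_map.1 hc
    obtain ⟨hl, hne⟩ := List.mem_filter.1 hl
    have hne : l ≠ [] := by simpa using hne
    obtain ⟨x, t, rfl⟩ := List.exists_cons_of_ne_nil hne
    obtain ⟨l', hl', hx⟩ := List.mem_flatten.1 (f2 x)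
    have hne' : l' ≠ [] := List.ne_nil_of_mem hx
    refine List.mem_map.2 ⟨l', List.mem_filter.2 ⟨hl', by simpa using hne'⟩, ?_⟩
    exact Cycle.coe_eq_coe.2 (rot_of_share κ _ _ ((List.nodup_flatten.1 n2).1 _ hl')
      ((List.nodup_flatten.1 n1).1 _ hl) (t2 _ hl' hne') (t1 _ hl hne) x hx (by simp))
  have hp : ((ne (Cs ++ [c0])).map (fun l : List C => (l : Cycle C))).Perm
      ((ne (Cs' ++ [c0'])).map (fun l : List C => (l : Cycle C))) := by
    rw [List.perm_ext_iff_of_nodup (ne_nodup _ n1) (ne_nodup _ n2)]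
    exact fun c => ⟨key _ _ n1 n2 f2 hκ hκ' c, key _ _ n2 n1 f1 hκ' hκ c⟩
  refine ⟨?_, hp⟩
  have hlen := hp.length_eq
  rw [List.length_map, List.length_map] at hlen
  rw [← hlen] at p2
  have e2 : (Fintype.card (C ⊕ Bool) : ℚ) ^ ((Cs' ++ [c0']).length + Fintype.card V)
      = (Fintype.card (C ⊕ Bool) : ℚ) ^ ((Cs ++ [c0]).length + Fintype.card V') := by
    rw [pow_add, pow_add, ← p1, ← p2]
    linear_combination (Fintype.card (C ⊕ Bool) : ℚ) ^ (ne (Cs ++ [c0])).length * e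
  have e3 : (Fintype.card (C ⊕ Bool)) ^ ((Cs' ++ [c0']).length + Fintype.card V)
      = (Fintype.card (C ⊕ Bool)) ^ ((Cs ++ [c0]).length + Fintype.card V') := by exact_mod_cast e2
  have e4 := Nat.pow_right_injective (by simp) e3
  rw [h.card hf, h'.card hf'] at e4
  simp at e4
  omega

end uniq

set_option linter.unusedSectionVars false
section fp
open Monoid.CoprodI
variable {ι : Type} {M : ι → Type} [∀ i, CommGroup (M i)] [DecidableEq ι] [∀ i, DecidableEq (M i)]

/-- the first syllable in the factor `j` -/
def hd (j : ι) (g : Monoid.CoprodI M) : M j := (Word.equivPair j (g • (Word.empty : Word M))).head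

theorem hd_of_mul (j : ι) (m : M j) (g : Monoid.CoprodI M) : hd j (of m * g) = m * hd j g := by
  unfold hd
  rw [mul_smul, Word.equivPair_smul_same]

theorem hd_one (j : ι) : hd j (1 : Monoid.CoprodI M) = 1 := by
  unfold hd
  rw [one_smul, Word.equivPair_eq_of_fstIdx_ne]
  simp [Word.fstIdx, Word.empty]

theorem hd_of (j : ι) (m : M j) : hd j (of m : Monoid.CoprodI M) = m := by
  have := hd_of_mul j m 1
  rwa [mul_one, hd_one, mul_one] at this

theorem hd_other (i j : ι) (h : i ≠ j) (g : Monoid.CoprodI M) (hi : hd i g ≠ 1) : hd j g = 1 := by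
  by_contra hj
  unfold hd at hi hj
  have h1 : Word.fstIdx (g • (Word.empty : Word M)) = some i := by
    by_contra h2
    rw [Word.equivPair_eq_of_fstIdx_ne h2] at hi
    exact hi rfl
  have h1' : Word.fstIdx (g • (Word.empty : Word M)) = some j := by
    by_contra h2
    rw [Word.equivPair_eq_of_fstIdx_ne h2] at hj
    exact hj rfl
  rw [h1] at h1'
  exact h (Option.some_injective _ h1')

theorem hd_of_ne (i j : ι) (h : i ≠ j) (m : M i) : hd j (of m : Monoid.CoprodI M) = 1 := by
  by_cases hm : m = 1
  · subst hm; rw [map_one, hd_one]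
  · exact hd_other i j h _ (by rwa [hd_of])

theorem hd_step (g : Monoid.CoprodI M) : ∀ (j i : ι) (s : M i),
    ((¬ ∃ x : M j, g = of x) ∨ i ≠ j) → hd j (g * of s) = hd j g := by
  obtain ⟨w, rfl⟩ := (Word.equiv (M := M)).symm.surjective g
  change ∀ (j i : ι) (s : M i), ((¬ ∃ x : M j, w.prod = of x) ∨ i ≠ j) → hd j (w.prod * of s) = hd j w.prod
  induction w using Word.consRecOn with
  | empty =>
    intro j i s h
    rw [Word.prod_empty]
    rcases h with h | h
    · exact absurd ⟨1, by simp⟩ h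
    · rw [one_mul, hd_one, hd_of_ne i j h]
  | cons i1 m w h1 h2 ih =>
    intro j i s h
    rw [Word.prod_cons] at h ⊢
    have hw : hd i1 w.prod = 1 := by
      have e : w.prod • (Word.empty : Word M) = w := Word.equiv.apply_symm_apply w
      unfold hd
      rw [e, Word.equivPair_eq_of_fstIdx_ne h1]
    rw [mul_assoc]
    by_cases hj : j = i1
    · subst hj
      rw [hd_of_mul, hd_of_mul, ih]
      rcases h with h | h
      · left
        rintro ⟨x, hx⟩
        exact h ⟨m * x, by rw [hx, map_mul]⟩
      · exact Or.inr h
    · have e1 : hd j (of m * w.prod) = 1 :=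
        hd_other i1 j (Ne.symm hj) _ (by rw [hd_of_mul, hw, mul_one]; exact h2)
      rw [e1]
      by_cases hc : (¬ ∃ x : M i1, w.prod = of x) ∨ i ≠ i1
      · apply hd_other i1 j (Ne.symm hj)
        rw [hd_of_mul, ih i1 i s hc, hw, mul_one]
        exact h2
      · push Not at hc
        obtain ⟨⟨x, hx⟩, rfl⟩ := hc
        rw [hx, ← map_mul, ← map_mul]
        exact hd_of_ne _ _ (Ne.symm hj) _

def IsSyl (x : Monoid.CoprodI M) : Prop := x = 1 ∨ ∃ (i : ι) (m : M i), x = of m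

theorem IsSyl.inv {x : Monoid.CoprodI M} (h : IsSyl x) : IsSyl x⁻¹ := by
  rcases h with rfl | ⟨i, m, rfl⟩
  · left; simp
  · right; exact ⟨i, m⁻¹, by simp⟩

theorem exists_syl (x : Monoid.CoprodI M) : ∃ l : List (Monoid.CoprodI M), (∀ y ∈ l, IsSyl y) ∧ l.prod = x := by
  induction x using Monoid.CoprodI.induction_left with
  | one => exact ⟨[], by simp, by simp⟩
  | mul m x ih =>
    obtain ⟨l, h1, rfl⟩ := ih
    refine ⟨of m :: l, ?_, by simp⟩
    intro y hy
    rcases List.mem_cons.1 hy with rfl | hy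
    · exact Or.inr ⟨_, m, rfl⟩
    · exact h1 y hy

theorem last_lemma {α : Type} (val : α → Monoid.CoprodI M) (j : ι) (m : M j) (R : List α)
    (hR : ∀ x ∈ R, IsSyl (val x)) :
    ∃ R1 R2, R = R1 ++ R2 ∧ of m * (R1.map val).prod = of (hd j (of m * (R.map val).prod)) := by
  induction R using List.reverseRecOn with
  | nil => exact ⟨[], [], rfl, by simp [hd_of]⟩
  | append_singleton R s ih =>
    obtain ⟨R1, R2, rfl, h⟩ := ih (fun x hx => hR x (by simp at hx ⊢; tauto))
    have hs := hR s (by simp)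
    by_cases hc : hd j (of m * (((R1 ++ R2) ++ [s]).map val).prod) = hd j (of m * ((R1 ++ R2).map val).prod)
    · exact ⟨R1, R2 ++ [s], by simp, by rw [hc, h]⟩
    · rcases hs with hs | ⟨i, x, hs⟩
      · rw [List.map_append (l₂ := [s]), List.prod_append] at hc
        simp [hs] at hc
      · have e : of m * (((R1 ++ R2) ++ [s]).map val).prod = of m * ((R1 ++ R2).map val).prod * of x := by
          rw [List.map_append (l₂ := [s]), List.prod_append]
          simp [hs, mul_assoc]
        rw [e] at hc
        have := mt (hd_step (of m * ((R1 ++ R2).map val).prod) j i x) hc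
        push Not at this
        obtain ⟨⟨y, hy⟩, rfl⟩ := this
        refine ⟨R1 ++ R2 ++ [s], [], by simp, ?_⟩
        rw [e, hy, ← map_mul, hd_of]

variable {V C : Type} [Fintype V] [DecidableEq V]

theorem ev_rev_inv {Γ : Type} [Group Γ] (f : V → Γ) (k : C → Γ) (l : List (Lt V C)) :
    (l.reverse.map (fun x => (gv f k x)⁻¹)).prod = (ev f k l)⁻¹ := by
  induction l with
  | nil => simp
  | cons x l ih =>
    rw [List.reverse_cons, List.map_append, List.prod_append, ih]
    simp

theorem grp1 {Γ : Type} [Group Γ] (p h r s : Γ) (e : p * (h * (r * (h⁻¹ * s))) = 1) :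
    h * r * h⁻¹ = (s * p)⁻¹ := by
  apply eq_inv_of_mul_eq_one_left
  calc h * r * h⁻¹ * (s * p) = p⁻¹ * (p * (h * (r * (h⁻¹ * s)))) * p := by group
    _ = 1 := by rw [e]; group

theorem grp2 {Γ : Type} [Group Γ] (c p h r1 r2 u : Γ) (e1 : c * p * h * r1 = 1)
    (e : p * (h * (r1 * r2 * (h⁻¹ * (u * c)))) = 1) :
    p * (u * (1 * (r2 * (r1 * (1⁻¹ * c))))) = 1 := by
  have h1 : p * h * r1 = c⁻¹ := by
    apply eq_inv_of_mul_eq_one_right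
    rw [← e1]; group
  have h2 : r2 * h⁻¹ * u = 1 := by
    calc r2 * h⁻¹ * u = (p * h * r1)⁻¹ * (p * (h * (r1 * r2 * (h⁻¹ * (u * c))))) * c⁻¹ := by group
      _ = 1 := by rw [e, h1]; group
  have h3 : u * r2 = h := by
    calc u * r2 = u * (r2 * h⁻¹ * u) * u⁻¹ * h := by group
      _ = h := by rw [h2]; group
  calc p * (u * (1 * (r2 * (r1 * (1⁻¹ * c))))) = p * (u * r2) * r1 * c := by group
    _ = 1 := by rw [h3, h1]; group

theorem perm1 {α : Type} (a T R1 R2 S : List α) (x y : α) :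
    (a ++ T ++ x :: (R1 ++ R2 ++ y :: S)).Perm (a ++ x :: (R2 ++ (R1 ++ y :: (T ++ S)))) := by
  classical
  rw [List.perm_iff_count]
  intro x
  simp only [List.count_append, List.count_cons]; omega

theorem perm2 {α : Type} (P R1 R2 U c : List α) (x y : α) :
    (P ++ x :: (R1 ++ R2 ++ y :: (U ++ c))).Perm (P ++ (U ++ x :: (R2 ++ (R1 ++ y :: c)))) := by
  classical
  rw [List.perm_iff_count]
  intro x
  simp only [List.count_append, List.count_cons]; omega

theorem isSyl_gv (f : V → Monoid.CoprodI M) (k : C → Monoid.CoprodI M) (hf : ∀ v, IsSyl (f v)) (hk : ∀ a, IsSyl (k a))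
    (x : Lt V C) : IsSyl (gv f k x) := by
  rcases x with ⟨v, _ | _⟩ | a
  exacts [(hf v).inv, hf v, hk a]

theorem main_step (f : V → Monoid.CoprodI M) (k : C → Monoid.CoprodI M) (hf : ∀ v, IsSyl (f v)) (hk : ∀ a, IsSyl (k a))
    (Q : List (Lt V C)) (hQ : Full Q) (he : ev f k Q = 1) (v : V) :
    ∃ (Q' : List (Lt V C)), Q.Perm Q' ∧ Sim Q Q' ∧ ev (Function.update f v 1) k Q' = 1 := by
  classical
  by_cases hv : f v = 1
  · refine ⟨Q, List.Perm.refl _, Sim.refl _, ?_⟩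
    have : Function.update f v 1 = f := by rw [← hv]; simp
    rw [this, he]
  obtain ⟨b, P, R, S, rfl, aP, aR, aS⟩ := split_pair hQ.quad v true (hQ.2 _)
  have hset : Function.update f v 1 = setv f v b 1 := by simp [setv]
  rw [hset]
  have hgb := gv_bar f k v b
  have hs := isSyl_gv f k hf hk
  have hne : gv f k (Sum.inl (v, b)) ≠ 1 := by
    cases b
    · simpa [gv] using hv
    · simpa [gv] using hv
  obtain ⟨j, m, hm⟩ : ∃ (i : ι) (m : M i), gv f k (Sum.inl (v, b)) = of m :=
    (hs (Sum.inl (v, b))).resolve_left hne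
  simp only [ev_append, ev_cons, hgb, hm] at he
  by_cases hc : ∃ x : M j, of m * ev f k R = of x
  · obtain ⟨x, hx⟩ := hc
    refine ⟨_, List.Perm.refl _, Sim.refl _, ?_⟩
    simp only [ev_append, ev_cons, gv_setv, gv_setv_bar, ev_setv f k v b 1 _ aP, ev_setv f k v b 1 _ aR,
      ev_setv f k v b 1 _ aS]
    have hR : ev f k R = of (m⁻¹ * x) := by
      rw [map_mul, ← hx, map_inv, inv_mul_cancel_left]
    have hcom : of m * ev f k R = ev f k R * of m := by
      rw [hR, ← map_mul, ← map_mul, mul_comm]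
    rw [← mul_assoc (of m), hcom] at he
    simpa [mul_assoc] using he
  · have h1 := hd_step (of m * ev f k R) j j m⁻¹ (Or.inl hc)
    obtain ⟨R1, R2, rfl, hR⟩ := last_lemma (gv f k) j m R (fun x _ => hs x)
    obtain ⟨T', U', hTU, hT⟩ := last_lemma (fun x => (gv f k x)⁻¹) j 1 (S ++ P).reverse (fun x _ => (hs x).inv)
    rw [ev_rev_inv, map_one, one_mul, one_mul] at hT
    have hT2 : (ev f k T'.reverse)⁻¹ = (T'.map (fun x => (gv f k x)⁻¹)).prod := by
      rw [← ev_rev_inv, List.reverse_reverse]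
    rw [← hT2] at hT
    have hSP : S ++ P = U'.reverse ++ T'.reverse := by
      rw [← List.reverse_append, ← hTU, List.reverse_reverse]
    have e1 : of m * ev f k (R1 ++ R2) * of m⁻¹ = (ev f k (S ++ P))⁻¹ := by
      rw [ev_append f k S P, map_inv]
      exact grp1 _ _ _ _ he
    rw [e1] at h1
    rw [h1] at hT
    have hR' : of m * ev f k R1 = of (hd j (of m * ev f k (R1 ++ R2))) := hR
    rw [← hT] at hR'
    generalize U'.reverse = U at *
    generalize T'.reverse = T at *
    have hk1 : ev f k T * of m * ev f k R1 = 1 := by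
      rw [mul_assoc, hR', mul_inv_cancel]
    clear hR hT hT2 hTU h1 e1 hR' hc hne
    simp only [avoid_append] at aR
    rcases List.append_eq_append_iff.1 hSP with ⟨a', rfl, rfl⟩ | ⟨c', rfl, rfl⟩
    · simp only [avoid_append] at aP
      refine ⟨a' ++ Sum.inl (v, b) :: (R2 ++ (R1 ++ Sum.inl (v, !b) :: (T ++ S))), ?_, ?_, ?_⟩
      · exact perm1 _ _ _ _ _ _ _
      · intro K _ _ _ X
        have := MM_slide X a' R2 S T R1 v b (by simp [aP, aR, aS])
        simp only [List.append_assoc] at this ⊢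
        rw [this]
      · simp only [ev_append, ev_cons, gv_setv, gv_setv_bar, ev_setv f k v b 1 _ aP.1, ev_setv f k v b 1 _ aP.2,
          ev_setv f k v b 1 _ aR.1, ev_setv f k v b 1 _ aR.2, ev_setv f k v b 1 _ aS]
        simp only [ev_append] at he
        have h3 : (of m)⁻¹ = ev f k R1 * ev f k T := by
          rw [inv_eq_iff_mul_eq_one, ← mul_assoc, mul_eq_one_iff_eq_inv]
          rw [mul_assoc, mul_eq_one_iff_eq_inv'] at hk1
          exact hk1
        calc _ = ev f k a' * (ev f k R2 * ((ev f k R1 * ev f k T) * ev f k S)) := by group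
          _ = ev f k a' * (ev f k T * of m * ev f k R1) * (ev f k R2 * ((of m)⁻¹ * ev f k S)) := by
            rw [hk1, ← h3]; group
          _ = 1 := by rw [← he]; group
    · simp only [avoid_append] at aS
      refine ⟨P ++ (U ++ Sum.inl (v, b) :: (R2 ++ (R1 ++ Sum.inl (v, !b) :: c'))), ?_, ?_, ?_⟩
      · exact perm2 _ _ _ _ _ _ _
      · intro K _ _ _ X
        have := MM_slide' X P R1 c' R2 U v b (by simp [aP, aR, aS])
        simp only [List.append_assoc] at this ⊢
        rw [this]
      · simp only [ev_append, ev_cons, gv_setv, gv_setv_bar, ev_setv f k v b 1 _ aP,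
          ev_setv f k v b 1 _ aR.1, ev_setv f k v b 1 _ aR.2, ev_setv f k v b 1 _ aS.1, ev_setv f k v b 1 _ aS.2]
        simp only [ev_append] at he hk1
        exact grp2 _ _ _ _ _ _ hk1 he

end fp

set_option linter.unusedSectionVars false
section fp2
open Monoid.CoprodI
variable {ι : Type} {M : ι → Type} [∀ i, CommGroup (M i)] [DecidableEq ι] [∀ i, DecidableEq (M i)]
variable {C : Type}

theorem ev_trivial {V Γ : Type} [Group Γ] (k : C → Γ) (Q : List (Lt V C)) :
    ev (fun _ => 1) k Q = cv k (co Q) := by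
  induction Q with
  | nil => simp
  | cons x l ih =>
    rcases x with ⟨v, _ | _⟩ | a <;> simp [ih, gv]

theorem collapse {V : Type} [Fintype V] [DecidableEq V] (k : C → Monoid.CoprodI M) (hk : ∀ a, IsSyl (k a))
    (s : Finset V) : ∀ (f : V → Monoid.CoprodI M) (_ : ∀ v, IsSyl (f v)) (_ : ∀ v, v ∉ s → f v = 1)
    (Q : List (Lt V C)) (_ : Full Q) (_ : ev f k Q = 1),
    ∃ Q' : List (Lt V C), Full Q' ∧ Sim Q Q' ∧ cv k (co Q') = 1 := by
  induction s using Finset.induction_on with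
  | empty =>
    intro f _ h0 Q hQ he
    have : f = fun _ => 1 := funext fun v => h0 v (by simp)
    rw [this, ev_trivial] at he
    exact ⟨Q, hQ, Sim.refl _, he⟩
  | insert v s hv ih =>
    intro f hf h0 Q hQ he
    obtain ⟨Q1, p1, s1, e1⟩ := main_step f k hf hk Q hQ he v
    obtain ⟨Q2, f2, s2, e2⟩ := ih (Function.update f v 1) (by
      intro u
      by_cases hu : u = v
      · subst hu; left; simp
      · rw [Function.update_of_ne hu]; exact hf u) (by
      intro u hu
      by_cases huv : u = v
      · subst huv; simp
      · rw [Function.update_of_ne huv]; exact h0 u (by simp [hu, huv])) Q1 (hQ.perm p1) e1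
    exact ⟨Q2, f2, s1.trans s2, e2⟩

theorem perm_sub {α : Type} (P R S : List α) (x y z w : α) :
    (P ++ x :: (z :: R ++ w :: y :: S)).Perm (z :: w :: (P ++ x :: (R ++ y :: S))) := by
  classical
  rw [List.perm_iff_count]
  intro x
  simp only [List.count_append, List.count_cons, List.cons_append]; omega

theorem full_sub {V : Type} (P R S : List (Lt V C)) (v : V) (b : Bool)
    (h : Full (P ++ Sum.inl (v, b) :: (R ++ Sum.inl (v, !b) :: S))) :
    Full (P.map sb ++ Sum.inl (some v, b) :: (Sum.inl (none, b) :: R.map sb ++ Sum.inl (none, !b) ::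
        Sum.inl (some v, !b) :: S.map sb)) := by
  apply Full.perm _ (perm_sub _ _ _ _ _ _ _).symm
  have e : P.map sb ++ Sum.inl (some v, b) :: (R.map sb ++ Sum.inl (some v, !b) :: S.map sb)
    = (P ++ Sum.inl (v, b) :: (R ++ Sum.inl (v, !b) :: S)).map sb := by simp [sb]
  rw [e]
  generalize (P ++ Sum.inl (v, b) :: (R ++ Sum.inl (v, !b) :: S)) = Q at h
  have a2 : ∀ b, (Sum.inl (none, b) : Lt (Option V) C) ∉ Q.map sb := by
    intro b hb
    rw [List.mem_map] at hb
    obtain ⟨⟨u, b'⟩ | a, h, e⟩ := hb <;> simp [sb] at e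
  have inj : Function.Injective (sb : Lt V C → Lt (Option V) C) := by
    rintro (⟨u, b⟩ | a) (⟨u', b'⟩ | a') h <;> simp_all [sb]
  constructor
  · rw [List.nodup_cons, List.nodup_cons, List.mem_cons]
    refine ⟨?_, a2 _, h.1.map inj⟩
    rintro (h | h)
    · simp at h
    · exact a2 _ h
  · rintro (⟨_ | u, b'⟩ | a)
    · rcases Bool.eq_or_eq_not b' b with rfl | rfl <;> simp
    · exact List.mem_cons_of_mem _ (List.mem_cons_of_mem _ (List.mem_map.2 ⟨Sum.inl (u, b'), h.2 _, rfl⟩))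
    · exact List.mem_cons_of_mem _ (List.mem_cons_of_mem _ (List.mem_map.2 ⟨Sum.inr a, h.2 _, rfl⟩))

theorem ev_sub {V Γ : Type} [Group Γ] [DecidableEq V] (k : C → Γ) (f : V → Γ) (f' : Option V → Γ) (v : V)
    (hf : ∀ u, u ≠ v → f' (some u) = f u) (l : List (Lt V C)) (hl : Avoid v l) :
    ev f' k (l.map sb) = ev f k l := by
  unfold ev
  rw [List.map_map]
  congr 1
  apply List.map_congr_left
  rintro (⟨u, b⟩ | a) hx
  · have : u ≠ v := by rintro rfl; exact hl _ hx
    cases b <;> simp [sb, gv, hf u this]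
  · rfl

theorem subdiv (n : ℕ) : ∀ (V : Type) [Fintype V] [DecidableEq V] (k : C → Monoid.CoprodI M)
    (_ : ∀ a, IsSyl (k a)) (F : V → List (Monoid.CoprodI M)) (_ : ∀ v, ∀ y ∈ F v, IsSyl y)
    (_ : ∑ v, ((F v).length - 1) ≤ n)
    (Q : List (Lt V C)) (_ : Full Q) (_ : ev (fun v => (F v).prod) k Q = 1),
    ∃ (V' : Type) (_ : Fintype V') (_ : DecidableEq V') (Q' : List (Lt V' C)),
      Full Q' ∧ Sim Q Q' ∧ cv k (co Q') = 1 := by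
  induction n with
  | zero =>
    intro V _ _ k hk F hF hn Q hQ he
    refine ⟨V, inferInstance, inferInstance, collapse k hk Finset.univ _ ?_ (by simp) Q hQ he⟩
    intro v
    have h1 := Finset.sum_eq_zero_iff.1 (Nat.le_zero.1 hn) v (Finset.mem_univ v)
    have h2 := hF v
    rcases hv : F v with _ | ⟨x, _ | ⟨y, t⟩⟩
    · left; simp
    · rw [hv] at h2
      simpa using h2
    · rw [hv] at h1; simp at h1
  | succ n ih =>
    intro V _ _ k hk F hF hn Q hQ he
    by_cases hall : ∀ v, (F v).length ≤ 1
    · refine ⟨V, inferInstance, inferInstance, collapse k hk Finset.univ _ ?_ (by simp) Q hQ he⟩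
      intro v
      have h1 := hall v
      have h2 := hF v
      rcases hv : F v with _ | ⟨x, _ | ⟨y, t⟩⟩
      · left; simp
      · rw [hv] at h2
        simpa using h2
      · rw [hv] at h1; simp at h1
    · push Not at hall
      obtain ⟨v, hv⟩ := hall
      obtain ⟨x, y, t, hF'⟩ : ∃ x y t, F v = x :: y :: t := by
        rcases hv' : F v with _ | ⟨x, _ | ⟨y, t⟩⟩
        · simp [hv'] at hv
        · simp [hv'] at hv
        · exact ⟨x, y, t, rfl⟩
      obtain ⟨b, P, R, S, rfl, aP, aR, aS⟩ := split_pair hQ.quad v true (hQ.2 _)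
      let l1 : List (Monoid.CoprodI M) := if b then [x] else y :: t
      let l2 : List (Monoid.CoprodI M) := if b then y :: t else [x]
      let F' : Option V → List (Monoid.CoprodI M) := fun o => o.elim l2 (Function.update F v l1)
      have hsv := hF v
      rw [hF'] at hsv
      obtain ⟨V', i1, i2, Q', q1, q2, q3⟩ := ih (Option V) k hk F' (by
        rintro (_ | u) z hz
        · simp only [F', Option.elim_none, l2] at hz
          cases b <;> simp at hz <;> exact hsv z (by simp; tauto)
        · simp only [F', Option.elim_some] at hz
          by_cases hu : u = v
          · subst hu
            simp only [Function.update_self, l1] at hz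
            cases b <;> simp at hz <;> exact hsv z (by simp; tauto)
          · rw [Function.update_of_ne hu] at hz
            exact hF u z hz) (by
        rw [Fintype.sum_option]
        have e1 := Finset.add_sum_erase Finset.univ (fun u => (F u).length - 1) (Finset.mem_univ v)
        have e2 := Finset.add_sum_erase Finset.univ (fun u => (F' (some u)).length - 1) (Finset.mem_univ v)
        have e3 : ∑ u ∈ Finset.univ.erase v, ((F' (some u)).length - 1) = ∑ u ∈ Finset.univ.erase v, ((F u).length - 1) := by
          apply Finset.sum_congr rfl
          intro u hu
          simp [F', Function.update_of_ne (Finset.ne_of_mem_erase hu)]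
        have e4 : (F' none).length - 1 + ((F' (some v)).length - 1) = t.length := by
          cases b <;> simp [F', l1, l2]
        have e5 : (F v).length - 1 = t.length + 1 := by simp [hF']
        omega) _ (full_sub P R S v b hQ) (by
        have hne : ∀ u, u ≠ v → (fun o => (F' o).prod) (some u) = (fun u => (F u).prod) u := by
          intro u hu; simp [F', Function.update_of_ne hu]
        simp only [ev_append, ev_cons, List.cons_append] at he ⊢
        rw [ev_sub k _ _ v hne P aP, ev_sub k _ _ v hne R aR, ev_sub k _ _ v hne S aS]
        cases b
        · simp [gv, hF', F', l1, l2, mul_assoc] at he ⊢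
          exact he
        · simp [gv, hF', F', l1, l2, mul_assoc] at he ⊢
          exact he)
      exact ⟨V', i1, i2, Q', q1, (sim_subdiv P R S v b aP aR aS).trans q2, q3⟩

theorem collapse_all {V : Type} [Fintype V] [DecidableEq V] (k : C → Monoid.CoprodI M)
    (hk : ∀ a, IsSyl (k a)) (f : V → Monoid.CoprodI M) (Q : List (Lt V C)) (hQ : Full Q) (he : ev f k Q = 1) :
    ∃ (V' : Type) (_ : Fintype V') (_ : DecidableEq V') (Q' : List (Lt V' C)),
      Full Q' ∧ Sim Q Q' ∧ cv k (co Q') = 1 := by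
  choose F h1 h2 using fun v => exists_syl (f v)
  refine subdiv _ V k hk F h1 le_rfl Q hQ ?_
  simp_rw [h2]
  exact he

end fp2

set_option linter.unusedSectionVars false
section len
variable {Γ : Type} [Group Γ]

structure Len (ℓ : Γ → ℕ) : Prop where
  one : ℓ 1 = 0
  mul : ∀ x y, ℓ (x * y) ≤ ℓ x + ℓ y
  inv : ∀ x, ℓ x⁻¹ = ℓ x

/-- all running products satisfy `φ` -/
def AP {α : Type} (φ : Γ → Prop) (val : α → Γ) : Γ → List α → Prop
  | z, [] => φ z
  | z, x :: l => φ z ∧ AP φ val (z * val x) l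

variable {α : Type} {φ ψ : Γ → Prop} {val val' : α → Γ}

theorem AP.start {z : Γ} {l : List α} (h : AP φ val z l) : φ z := by
  cases l with
  | nil => exact h
  | cons x l => exact h.1

theorem AP.fin {z : Γ} {l : List α} (h : AP φ val z l) : φ (z * (l.map val).prod) := by
  induction l generalizing z with
  | nil => simpa [AP] using h
  | cons x l ih => simpa [mul_assoc] using ih h.2

theorem AP_append {z : Γ} {l l' : List α} :
    AP φ val z (l ++ l') ↔ AP φ val z l ∧ AP φ val (z * (l.map val).prod) l' := by
  induction l generalizing z with
  | nil =>
    simp only [List.nil_append, List.map_nil, List.prod_nil, mul_one]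
    exact ⟨fun h => ⟨h.start, h⟩, fun h => h.2⟩
  | cons x l ih =>
    simp only [List.cons_append, AP, ih, List.map_cons, List.prod_cons, mul_assoc, and_assoc]

theorem AP.shift {z : Γ} {l : List α} (h : AP φ val z l) (y : Γ) (hy : ∀ x, φ x → ψ (y * x)) :
    AP ψ val (y * z) l := by
  induction l generalizing z with
  | nil => exact hy _ h
  | cons x l ih =>
    refine ⟨hy _ h.1, ?_⟩
    rw [mul_assoc]
    exact ih h.2

theorem AP_congr {z : Γ} {l : List α} (hv : ∀ x ∈ l, val x = val' x) :
    AP φ val z l ↔ AP φ val' z l := by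
  induction l generalizing z with
  | nil => rfl
  | cons x l ih =>
    simp only [AP]
    rw [hv x (by simp), ih (fun x hx => hv x (List.mem_cons_of_mem _ hx))]

theorem AP.mem {z : Γ} {l : List α} (h : AP φ val z l) (x : α) (hx : x ∈ l) :
    ∃ y, φ y ∧ φ (y * val x) := by
  induction l generalizing z with
  | nil => simp at hx
  | cons x' l ih =>
    rcases List.mem_cons.1 hx with rfl | hx
    · exact ⟨z, h.1, h.2.start⟩
    · exact ih h.2 hx

variable {V C : Type} [DecidableEq V] {ℓ : Γ → ℕ}

theorem AP_setv {f : V → Γ} {k : C → Γ} {v : V} {b : Bool} {y z : Γ} {l : List (Lt V C)} (h : Avoid v l) :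
    AP φ (gv (setv f v b y) k) z l ↔ AP φ (gv f k) z l := by
  apply AP_congr
  intro x hx
  apply gv_setv_ne
  rintro b rfl
  exact h b hx

theorem Len.cv (hℓ : Len ℓ) {k : C → Γ} (hk : ∀ a, ℓ (k a) ≤ 1) (A : List C) : ℓ (cv k A) ≤ A.length := by
  induction A with
  | nil => simp [hℓ.one]
  | cons a A ih =>
    have := hℓ.mul (k a) (Stmt0.cv k A)
    have := hk a
    simp only [cv_cons, List.length_cons]
    omega

theorem AP_coef (hℓ : Len ℓ) {f : V → Γ} {k : C → Γ} (hk : ∀ a, ℓ (k a) ≤ 1) (A : List C) (y : Γ) (β : ℕ)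
    (h : ℓ y + A.length ≤ β) :
    AP (fun x => ℓ x ≤ β) (gv f k) y (A.map Sum.inr) := by
  induction A generalizing y with
  | nil => simpa [AP] using h
  | cons a A ih =>
    simp only [List.length_cons] at h
    refine ⟨by omega, ?_⟩
    apply ih
    have := hℓ.mul y (k a)
    have := hk a
    simp only [gv_inr]
    omega

/-- product of conjugated circles -/
def cp (k : C → Γ) (W : List (List C × Γ)) : Γ := (W.map fun e => e.2 * cv k e.1 * e.2⁻¹).prod

/-- product of commutators -/
def hp (H : List (Γ × Γ)) : Γ := (H.map fun e => e.1 * e.2 * e.1⁻¹ * e.2⁻¹).prod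

@[simp] theorem cp_nil (k : C → Γ) : cp k [] = 1 := rfl
@[simp] theorem cp_cons (k : C → Γ) (e) (W) : cp k (e :: W) = e.2 * cv k e.1 * e.2⁻¹ * cp k W := by
  simp [cp]
@[simp] theorem cp_append (k : C → Γ) (W W') : cp k (W ++ W') = cp k W * cp k W' := by
  simp [cp]
@[simp] theorem hp_nil : hp ([] : List (Γ × Γ)) = 1 := rfl
@[simp] theorem hp_cons (e : Γ × Γ) (W) : hp (e :: W) = e.1 * e.2 * e.1⁻¹ * e.2⁻¹ * hp W := by
  simp [hp]

theorem down_RU (hℓ : Len ℓ) {k : C → Γ} (hk : ∀ a, ℓ (k a) ≤ 1) {Q : List (Lt V C)} {Cs c0} (h : RU Q Cs c0) :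
    ∃ T : List (List C × Γ), T.map Prod.fst = Cs ∧ (∀ e ∈ T, ℓ e.2 ≤ (co Q).length) ∧
      cv k (co Q) = cp k T * cv k c0 := by
  induction h with
  | base c0 => exact ⟨[], by simp⟩
  | step D1 D2 A v b Cs c0 hp h1 h2 h ih =>
    obtain ⟨T, t1, t2, t3⟩ := ih
    refine ⟨(A, cv k (co D1)) :: T, by simp [t1], ?_, ?_⟩
    · intro e he
      rcases List.mem_cons.1 he with rfl | he
      · have := hℓ.cv hk (co D1)
        simp; omega
      · have := t2 e he
        simp at this ⊢; omega
    · simp only [co_append, co_cons_inl, co_map_inr, cv_append, cp_cons] at t3 ⊢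
      rw [mul_assoc _ (cp k T), ← t3]
      group

theorem down_RH (hℓ : Len ℓ) {k : C → Γ} (hk : ∀ a, ℓ (k a) ≤ 1) {Q : List (Lt V C)} {g Cs c0} (h : RH Q g Cs c0) :
    ∃ (H : List (Γ × Γ)) (T : List (List C × Γ)), H.length = g ∧ T.map Prod.fst = Cs ∧
      (∀ e ∈ H, ℓ e.1 ≤ 2 * (co Q).length ∧ ℓ e.2 ≤ 2 * (co Q).length) ∧
      (∀ e ∈ T, ℓ e.2 ≤ (co Q).length) ∧
      cv k (co Q) = hp H * (cp k T * cv k c0) := by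
  induction h with
  | base Q Cs c0 h =>
    obtain ⟨T, t1, t2, t3⟩ := down_RU hℓ hk h
    exact ⟨[], T, rfl, t1, by simp, t2, by simpa using t3⟩
  | step D1 A B E D2 v u b b' g Cs c0 huv h1 h2 h ih =>
    obtain ⟨H, T, t0, t1, t2, t3, t4⟩ := ih
    have hlen : (co (D1 ++ Sum.inl (v, b) :: (A ++ Sum.inl (u, b') :: (B ++ Sum.inl (v, !b) ::
        (E ++ Sum.inl (u, !b') :: D2))))).length = (co (D1 ++ (E ++ (B ++ (A ++ D2))))).length := by
      simp; omega
    rw [hlen]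
    simp only [co_append, co_cons_inl, cv_append] at t4 ⊢
    have l1 := hℓ.cv hk (co D1)
    have l2 := hℓ.cv hk (co A)
    have l3 := hℓ.cv hk (co B)
    have l4 := hℓ.cv hk (co E)
    have hlen2 : (co (D1 ++ (E ++ (B ++ (A ++ D2))))).length = (co D1).length + ((co E).length +
      ((co B).length + ((co A).length + (co D2).length))) := by simp
    simp only [co_append] at hlen2 t2 t3 ⊢
    generalize cv k (co D1) = d1 at *
    generalize cv k (co A) = a at *
    generalize cv k (co B) = bb at *
    generalize cv k (co E) = e at *
    refine ⟨(d1 * bb⁻¹ * e⁻¹ * d1⁻¹, d1 * e * bb * a * e⁻¹ * d1⁻¹) :: H, T, by simp [t0], t1, ?_, t3, ?_⟩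
    · intro x hx
      rcases List.mem_cons.1 hx with rfl | hx
      · simp only
        have := hℓ.inv d1
        have := hℓ.inv bb
        have := hℓ.inv e
        have := hℓ.mul (d1 * bb⁻¹ * e⁻¹) d1⁻¹
        have := hℓ.mul (d1 * bb⁻¹) e⁻¹
        have := hℓ.mul d1 bb⁻¹
        have := hℓ.mul (d1 * e * bb * a * e⁻¹) d1⁻¹
        have := hℓ.mul (d1 * e * bb * a) e⁻¹
        have := hℓ.mul (d1 * e * bb) a
        have := hℓ.mul (d1 * e) bb
        have := hℓ.mul d1 e
        omega
      · exact t2 x hx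
    · rw [hp_cons, mul_assoc _ (hp H), ← t4]
      simp only
      group

end len

set_option linter.unusedSectionVars false
section sort
variable {Γ : Type} [Group Γ] {C : Type} [DecidableEq C] {ℓ : Γ → ℕ}

def lam (ℓ : Γ → ℕ) (U : List (List C × Γ)) : ℕ := (U.map fun e => 2 * ℓ e.2 + e.1.length).sum

theorem lam_cons (e) (U : List (List C × Γ)) : lam ℓ (e :: U) = 2 * ℓ e.2 + e.1.length + lam ℓ U := by
  simp [lam]
theorem lam_append (U U' : List (List C × Γ)) : lam ℓ (U ++ U') = lam ℓ U + lam ℓ U' := by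
  simp [lam]

theorem len_cp (hℓ : Len ℓ) {k : C → Γ} (hk : ∀ a, ℓ (k a) ≤ 1) (U : List (List C × Γ)) :
    ℓ (cp k U) ≤ lam ℓ U := by
  induction U with
  | nil => simp [hℓ.one]
  | cons e U ih =>
    rw [cp_cons, lam_cons]
    have := hℓ.mul (e.2 * cv k e.1 * e.2⁻¹) (cp k U)
    have := hℓ.mul (e.2 * cv k e.1) e.2⁻¹
    have := hℓ.mul e.2 (cv k e.1)
    have := hℓ.cv hk e.1
    have := hℓ.inv e.2
    omega

theorem sort_circles (hℓ : Len ℓ) {k : C → Γ} (hk : ∀ a, ℓ (k a) ≤ 1) (T : List (List C))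
    (U : List (List C × Γ))
    (hp : ((ne T).map (fun l : List C => (l : Cycle C))).Perm (U.map fun e => ((e.1 : List C) : Cycle C))) :
    ∃ W : List (List C × Γ), W.map Prod.fst = T ∧ cp k W = cp k U ∧ (∀ e ∈ W, ℓ e.2 ≤ lam ℓ U) ∧
      ∀ W1 W2, W = W1 ++ W2 → ℓ (cp k W2) ≤ lam ℓ U := by
  induction T generalizing U with
  | nil =>
    have : U = [] := by simpa [ne] using hp
    subst this
    refine ⟨[], rfl, rfl, by simp, ?_⟩
    intro W1 W2 h
    have h := (List.append_eq_nil_iff.1 h.symm).2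
    subst h
    simp [hℓ.one]
  | cons c T ih =>
    by_cases hc : c = []
    · subst hc
      obtain ⟨W, w1, w2, w3, w4⟩ := ih U (by simpa [ne] using hp)
      refine ⟨([], 1) :: W, by simp [w1], by simp [w2], ?_, ?_⟩
      · intro e he
        rcases List.mem_cons.1 he with rfl | he
        · simp [hℓ.one]
        · exact w3 e he
      · intro W1 W2 h
        cases W1 with
        | nil =>
          simp only [List.nil_append] at h
          rw [← h]
          simp only [cp_cons, cv_nil, mul_one, inv_one, one_mul, w2]
          exact len_cp hℓ hk U
        | cons a W1 =>
          simp only [List.cons_append, List.cons.injEq] at h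
          exact w4 _ _ h.2
    · have hne : ne (c :: T) = c :: ne T := by simp [ne, hc]
      rw [hne, List.map_cons] at hp
      have hm := hp.mem_iff.1 List.mem_cons_self
      obtain ⟨e, he, hec⟩ := List.mem_map.1 hm
      obtain ⟨U1, U2, rfl⟩ := List.append_of_mem he
      have hp' : ((ne T).map (fun l : List C => (l : Cycle C))).Perm
          ((U1 ++ U2).map fun e => ((e.1 : List C) : Cycle C)) := by
        rw [← List.perm_cons ((c : List C) : Cycle C)]
        refine hp.trans ?_
        simp only [List.map_append, List.map_cons, hec]
        exact List.perm_middle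
      obtain ⟨W, w1, w2, w3, w4⟩ := ih _ hp'
      have hrot : e.1 ~r c := Cycle.coe_eq_coe.1 hec
      obtain ⟨x, y, hx, hy⟩ : ∃ x y, e.1 = x ++ y ∧ c = y ++ x := by
        obtain ⟨n, hn⟩ := hrot
        rw [List.rotate_eq_drop_append_take_mod] at hn
        exact ⟨_, _, (List.take_append_drop _ _).symm, hn.symm⟩
      have hl : lam ℓ (U1 ++ U2) ≤ lam ℓ (U1 ++ e :: U2) := by
        simp only [lam_append, lam_cons]; omega
      have hcp : cp k ((c, cp k U1 * e.2 * cv k x) :: W) = cp k (U1 ++ e :: U2) := by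
        simp only [cp_cons, cp_append, w2, hx, hy, cv_append]
        group
      refine ⟨(c, cp k U1 * e.2 * cv k x) :: W, by simp [w1], hcp, ?_, ?_⟩
      · intro e' he'
        rcases List.mem_cons.1 he' with rfl | he'
        · simp only [lam_append, lam_cons]
          have := hℓ.mul (cp k U1 * e.2) (cv k x)
          have := hℓ.mul (cp k U1) e.2
          have := len_cp hℓ hk U1
          have := hℓ.cv hk x
          have : x.length ≤ e.1.length := by rw [hx]; simp
          omega
        · exact (w3 e' he').trans hl
      · intro W1 W2 h
        cases W1 with
        | nil =>
          simp only [List.nil_append] at h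
          rw [← h, hcp]
          exact len_cp hℓ hk _
        | cons a W1 =>
          simp only [List.cons_append, List.cons.injEq] at h
          exact (w4 _ _ h.2).trans hl

end sort

section up
variable {Γ : Type} [Group Γ] {V C : Type} [DecidableEq V] {ℓ : Γ → ℕ}

theorem up_RU (hℓ : Len ℓ) {k : C → Γ} (hk : ∀ a, ℓ (k a) ≤ 1) {Q : List (Lt V C)} {Cs c0}
    (h : RU Q Cs c0) (c L : ℕ) (z : Γ) (hz : ℓ z ≤ L) (hc : (co Q).length ≤ c)
    (W : List (List C × Γ)) (hW : W.map Prod.fst = Cs) (hL : ∀ e ∈ W, ℓ e.2 ≤ L) :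
    ∃ f : V → Γ, z * ev f k Q = cp k W * (z * cv k c0) ∧
      (∀ P s, Q = P ++ s → NoPair P → AP (fun x => ℓ x ≤ L + c) (gv f k) z P) ∧
      (∀ y0 β, (∀ W1 W2, W = W1 ++ W2 → ℓ (y0 * cp k W1) ≤ β) →
        AP (fun x => ℓ x ≤ β + (L + c)) (gv f k) (y0 * z) Q) := by
  induction h generalizing W with
  | base c0 =>
    have : W = [] := by simpa using hW
    subst this
    simp only [co_map_inr] at hc
    have key : AP (fun x => ℓ x ≤ L + c) (gv (fun _ : V => (1 : Γ)) k) z (c0.map Sum.inr) :=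
      AP_coef hℓ hk _ _ _ (by omega)
    refine ⟨fun _ => 1, by simp, ?_, ?_⟩
    · intro P s hPs _
      rw [hPs, AP_append] at key
      exact key.1
    · intro y0 β hβ
      have h0 := hβ [] [] rfl
      simp only [cp_nil, mul_one] at h0
      refine key.shift y0 ?_
      intro x hx
      have := hℓ.mul y0 x
      omega
  | step D1 D2 A v b Cs c0 hp h1 h2 h ih =>
    cases W with
    | nil => simp at hW
    | cons e W =>
    simp only [List.map_cons, List.cons.injEq] at hW
    obtain ⟨rfl, hW⟩ := hW
    have hcA : e.1.length ≤ c := by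
      simp at hc; omega
    obtain ⟨f, f1, f2, f3⟩ := ih (by simp at hc ⊢; omega) W hW (fun e he => hL e (List.mem_cons_of_mem _ he))
    have het := hL e List.mem_cons_self
    set X : Γ := (z * ev f k D1)⁻¹ * e.2 with hX
    have hD1 : AP (fun x => ℓ x ≤ L + c) (gv f k) z D1 := f2 D1 D2 rfl hp
    have hev : ∀ l : List (Lt V C), (l.map (gv (setv f v b X) k)).prod = ev (setv f v b X) k l := fun l => rfl
    have hpre : AP (fun x => ℓ x ≤ L + c) (gv (setv f v b X) k) z
        (D1 ++ Sum.inl (v, b) :: e.1.map Sum.inr) := by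
      rw [AP_append, AP_setv h1, hev, ev_setv _ _ _ _ _ _ h1]
      refine ⟨hD1, ?_, ?_⟩
      · exact hD1.fin
      · rw [gv_setv]
        apply AP_coef hℓ hk
        have : z * ev f k D1 * X = e.2 := by rw [hX]; group
        rw [this]; omega
    refine ⟨setv f v b X, ?_, ?_, ?_⟩
    · simp only [ev_append, ev_cons, ev_map_inr, gv_setv, gv_setv_bar, ev_setv _ _ _ _ _ _ h1,
        ev_setv _ _ _ _ _ _ h2, cp_cons] at f1 ⊢
      rw [mul_assoc _ (cp k W), ← f1, hX]
      group
    · intro P s hPs hnp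
      have hpre' : ∃ R, P ++ R = D1 ++ Sum.inl (v, b) :: e.1.map Sum.inr := by
        have e2 : D1 ++ Sum.inl (v, b) :: (e.1.map Sum.inr ++ Sum.inl (v, !b) :: D2)
          = (D1 ++ Sum.inl (v, b) :: e.1.map Sum.inr) ++ (Sum.inl (v, !b) :: D2) := by simp
        rw [e2] at hPs
        rcases List.append_eq_append_iff.1 hPs with ⟨R, hR, hR2⟩ | ⟨R, hR, _⟩
        · cases R with
          | nil => exact ⟨[], by rw [hR]; simp⟩
          | cons a R =>
            simp only [List.cons_append, List.cons.injEq] at hR2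
            obtain ⟨rfl, _⟩ := hR2
            exfalso
            refine hnp v b ?_ ?_
            · rw [hR]; simp
            · rw [hR]; simp
        · exact ⟨R, hR.symm⟩
      obtain ⟨R, hR⟩ := hpre'
      rw [← hR, AP_append] at hpre
      exact hpre.1
    · intro y0 β hβ
      have h0 := hβ [] _ rfl
      simp only [cp_nil, mul_one] at h0
      have e2 : D1 ++ Sum.inl (v, b) :: (e.1.map Sum.inr ++ Sum.inl (v, !b) :: D2)
              = (D1 ++ Sum.inl (v, b) :: e.1.map Sum.inr) ++ (Sum.inl (v, !b) :: D2) := by simp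
      rw [e2, AP_append]
      have q1 : AP (fun x => ℓ x ≤ β + (L + c)) (gv (setv f v b X) k) (y0 * z)
        (D1 ++ Sum.inl (v, b) :: e.1.map Sum.inr) := by
        refine hpre.shift y0 ?_
        intro x hx
        have := hℓ.mul y0 x
        omega
      refine ⟨q1, ?_, ?_⟩
      · exact q1.fin
      · have q2 := f3 (y0 * (e.2 * cv k e.1 * e.2⁻¹)) β (by
          intro W1 W2 hW12
          have := hβ (e :: W1) W2 (by rw [hW12]; rfl)
          simpa only [cp_cons, mul_assoc] using this)
        rw [AP_append] at q2
        rw [AP_setv h2]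
        convert q2.2 using 1
        rw [hev]
        change _ = _ * ev f k D1
        simp only [ev_append, ev_cons, ev_map_inr, gv_setv, gv_setv_bar, ev_setv _ _ _ _ _ _ h1]
        rw [hX]
        group

theorem up_RH (hℓ : Len ℓ) {k : C → Γ} (hk : ∀ a, ℓ (k a) ≤ 1) {Q : List (Lt V C)} {g Cs c0}
    (h : RH Q g Cs c0) (c L : ℕ) (z : Γ) (hz : ℓ z ≤ L) (hc : (co Q).length ≤ c)
    (W : List (List C × Γ)) (hW : W.map Prod.fst = Cs) (hL : ∀ e ∈ W, ℓ e.2 ≤ L)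
    (β m : ℕ) (hβ : ∀ W1 W2, W = W1 ++ W2 → ℓ (cp k W1) ≤ β)
    (H : List (Γ × Γ)) (hH : H.length = g) (hm : ∀ e ∈ H, ℓ e.1 ≤ m ∧ ℓ e.2 ≤ m) :
    ∃ f : V → Γ, z * ev f k Q = hp H * (cp k W * (z * cv k c0)) ∧
      AP (fun x => ℓ x ≤ 4 * m * g + (β + (L + c))) (gv f k) z Q := by
  induction h generalizing H with
  | base Q Cs c0 h =>
    obtain ⟨f, f1, f2, f3⟩ := up_RU hℓ hk h c L z hz hc W hW hL
    have : H = [] := by simpa using hH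
    subst this
    refine ⟨f, by simpa using f1, ?_⟩
    have := f3 1 β (by simpa using hβ)
    simpa using this
  | step D1 A B E D2 v u b b' g Cs c0 huv h1 h2 h ih =>
    cases H with
    | nil => simp at hH
    | cons e H =>
    obtain ⟨p, q⟩ := e
    obtain ⟨f, f1, f2⟩ := ih (by simp at hc ⊢; omega) hW H (by simpa using hH)
      (fun e he => hm e (List.mem_cons_of_mem _ he))
    obtain ⟨hmp, hmq⟩ := hm _ List.mem_cons_self
    simp only at hmp hmq
    simp only [avoid_append] at h1 h2
    obtain ⟨v1, v2, v3, v4, v5⟩ := h1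
    obtain ⟨u1, u2, u3, u4, u5⟩ := h2
    set d1 := ev f k D1 with hd1
    set a := ev f k A with ha
    set bb := ev f k B with hbb
    set ee := ev f k E with hee
    set d2 := ev f k D2 with hd2
    set X : Γ := (z * d1)⁻¹ * p * (z * d1 * ee * bb) with hX
    set Y : Γ := (z * d1 * ee * bb * a)⁻¹ * q * (z * d1 * ee) with hY
    set F : V → Γ := setv (setv f v b X) u b' Y with hF
    have fr : ∀ l : List (Lt V C), Avoid v l → Avoid u l → ev F k l = ev f k l := by
      intro l hv hu
      rw [hF, ev_setv _ _ _ _ _ _ hu, ev_setv _ _ _ _ _ _ hv]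
    have fa : ∀ (l : List (Lt V C)) (φ : Γ → Prop) (y : Γ), Avoid v l → Avoid u l →
        (AP φ (gv F k) y l ↔ AP φ (gv f k) y l) := by
      intro l φ y hv hu
      rw [hF, AP_setv hu, AP_setv hv]
    have gX : gv F k (Sum.inl (v, b)) = X := by
      rw [hF, gv_setv_ne, gv_setv]
      rintro b'' he
      simp only [Sum.inl.injEq, Prod.mk.injEq] at he
      exact huv he.1.symm
    have gX' : gv F k (Sum.inl (v, !b)) = X⁻¹ := by rw [gv_bar, gX]
    have gY : gv F k (Sum.inl (u, b')) = Y := by rw [hF, gv_setv]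
    have gY' : gv F k (Sum.inl (u, !b')) = Y⁻¹ := by rw [gv_bar, gY]
    have hev : ∀ (f : V → Γ) (l : List (Lt V C)), (l.map (gv f k)).prod = ev f k l := fun f l => rfl
    simp only [AP_append, hev, ← hd1, ← ha, ← hbb, ← hee] at f2
    obtain ⟨r1, r2, r3, r4, r5⟩ := f2
    have hmul : 4 * m * (g + 1) = 4 * m * g + 4 * m := by ring
    have sh : ∀ (y : Γ) (x : Γ), ℓ y ≤ 4 * m → ℓ x ≤ 4 * m * g + (β + (L + c)) →
        ℓ (y * x) ≤ 4 * m * (g + 1) + (β + (L + c)) := by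
      intro y x hy hx
      have := hℓ.mul y x
      omega
    have y2 : ℓ (p * q) ≤ 2 * m := by have := hℓ.mul p q; omega
    have y3 : ℓ (p * q * p⁻¹) ≤ 3 * m := by
      have := hℓ.mul (p * q) p⁻¹; have := hℓ.inv p; omega
    have y4 : ℓ (p * q * p⁻¹ * q⁻¹) ≤ 4 * m := by
      have := hℓ.mul (p * q * p⁻¹) q⁻¹; have := hℓ.inv q; omega
    have s1 := r1.shift (ψ := fun x => ℓ x ≤ 4 * m * (g + 1) + (β + (L + c))) 1
      (fun x hx => sh _ x (by simp [hℓ.one]) hx)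
    have s2 := r4.shift (ψ := fun x => ℓ x ≤ 4 * m * (g + 1) + (β + (L + c))) p
      (fun x hx => sh _ x (by omega) hx)
    have s3 := r3.shift (ψ := fun x => ℓ x ≤ 4 * m * (g + 1) + (β + (L + c))) (p * q)
      (fun x hx => sh _ x (by omega) hx)
    have s4 := r2.shift (ψ := fun x => ℓ x ≤ 4 * m * (g + 1) + (β + (L + c))) (p * q * p⁻¹)
      (fun x hx => sh _ x (by omega) hx)
    have s5 := r5.shift (ψ := fun x => ℓ x ≤ 4 * m * (g + 1) + (β + (L + c))) (p * q * p⁻¹ * q⁻¹)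
      (fun x hx => sh _ x (by omega) hx)
    rw [one_mul] at s1
    refine ⟨F, ?_, ?_⟩
    · simp only [ev_append, ev_cons, gX, gX', gY, gY', fr D1 v1 u1, fr A v4 u4, fr B v3 u3, fr E v2 u2,
        fr D2 v5 u5, hp_cons, ← hd1, ← ha, ← hbb, ← hee, ← hd2] at f1 ⊢
      rw [mul_assoc _ (hp H), ← f1, hX, hY]
      group
    · have t1 : z * d1 * X = p * (z * d1 * ee * bb) := by rw [hX]; group
      have t2 : p * (z * d1 * ee * bb) * a * Y = p * q * (z * d1 * ee) := by rw [hY]; group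
      have t3 : p * q * (z * d1 * ee) * bb * X⁻¹ = p * q * p⁻¹ * (z * d1) := by rw [hX]; group
      have t4 : p * q * p⁻¹ * (z * d1) * ee * Y⁻¹ = p * q * p⁻¹ * q⁻¹ * (z * d1 * ee * bb * a) := by
        rw [hY]; group
      simp only [AP_append, AP, hev, fa D1 _ _ v1 u1, fa A _ _ v4 u4, fa B _ _ v3 u3, fa E _ _ v2 u2,
        fa D2 _ _ v5 u5, gX, gX', gY, gY', fr D1 v1 u1, fr A v4 u4, fr B v3 u3, fr E v2 u2,
        ← hd1, ← ha, ← hbb, ← hee, t1, t2, t3, t4]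
      refine ⟨s1, s1.fin, s2, s2.fin, s3, s3.fin, s4, s4.fin, s5⟩

end up

set_option linter.unusedSectionVars false
section comb
variable {Γ : Type} [Group Γ] {C : Type} [DecidableEq C] [Fintype C] {ℓ : Γ → ℕ}

theorem cp_filter (k : C → Γ) (T : List (List C × Γ)) :
    cp k (T.filter fun e => decide (e.1 ≠ [])) = cp k T := by
  induction T with
  | nil => rfl
  | cons e T ih =>
    by_cases he : e.1 = []
    · rw [List.filter_cons_of_neg (by simpa using he), ih, cp_cons, he]
      simp
    · rw [List.filter_cons_of_pos (by simpa using he), cp_cons, cp_cons, ih]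

theorem fst_filter (T : List (List C × Γ)) :
    (T.filter fun e => decide (e.1 ≠ [])).map Prod.fst = ne (T.map Prod.fst) := by
  simp only [ne, List.filter_map]
  rfl

theorem lam_le (T : List (List C × Γ)) (m : ℕ) (h : ∀ e ∈ T, ℓ e.2 ≤ m) :
    lam ℓ (T.filter fun e => decide (e.1 ≠ [])) ≤ (2 * m + 1) * (T.map Prod.fst).flatten.length := by
  induction T with
  | nil => simp [lam]
  | cons e T ih =>
    have ih := ih (fun e he => h e (List.mem_cons_of_mem _ he))
    have h0 := h e List.mem_cons_self
    by_cases he : e.1 = []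
    · simpa [he] using ih
    · have hpos : 0 < e.1.length := List.length_pos_iff.2 he
      rw [List.filter_cons_of_pos (by simpa using he), lam_cons]
      simp only [List.map_cons, List.flatten_cons, List.length_append, mul_add]
      nlinarith

theorem final_bound (hℓ : Len ℓ) {k : C → Γ} (hk : ∀ a, ℓ (k a) ≤ 1)
    {V V' : Type} [Fintype V] [Fintype V'] [DecidableEq V] [DecidableEq V']
    (Q : List (Lt V C)) (Q' : List (Lt V' C)) (hQ : Full Q) (hQ' : Full Q') (hs : Sim Q Q')
    (he : cv k (co Q') = 1) :
    ∃ f : V → Γ, ev f k Q = 1 ∧ ∀ v, ℓ (f v) ≤ 100 * (Fintype.card V + Fintype.card C) ^ 2 := by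
  obtain ⟨g, Cs, c0, h⟩ := exists_RH _ Q le_rfl hQ.quad
  obtain ⟨g', Cs', c0', h'⟩ := exists_RH _ Q' le_rfl hQ'.quad
  obtain ⟨rfl, hperm⟩ := uniq hQ h hQ' h' hs
  obtain ⟨H, T, hH, hT, hHm, hTm, hval⟩ := down_RH hℓ hk h'
  have hcard := RH.card hQ h
  have hco := hQ.co_length
  have hco' := hQ'.co_length
  set c := Fintype.card C with hc
  set n := Fintype.card V with hn
  rw [hco'] at hHm hTm
  rw [he] at hval
  set T1 : List (List C × Γ) := T ++ [(c0', 1)] with hT1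
  have hT1m : ∀ e ∈ T1, ℓ e.2 ≤ c := by
    intro e he
    rcases List.mem_append.1 he with he | he
    · exact hTm e he
    · have : e = (c0', 1) := by simpa using he
      rw [this]; simp [hℓ.one]
  have hT1f : T1.map Prod.fst = Cs' ++ [c0'] := by simp [hT1, hT]
  set U := T1.filter fun e => decide (e.1 ≠ []) with hU
  have hUf : U.map (fun e => ((e.1 : List C) : Cycle C)) =
      (ne (Cs' ++ [c0'])).map (fun l : List C => (l : Cycle C)) := by
    rw [← hT1f, ← fst_filter, List.map_map]; rfl
  have hlam : lam ℓ U ≤ (2 * c + 1) * c := by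
    have h1 := lam_le T1 c hT1m
    have h2 := (h'.perm).1.length_eq
    rw [hT1f] at h1
    have h3 : (Cs' ++ [c0']).flatten.length = c := by
      rw [← hco', h2]; simp
    rw [h3] at h1
    exact h1
  obtain ⟨W, w1, w2, w3, w4⟩ := sort_circles hℓ hk (Cs ++ [c0]) U (by rw [hUf]; exact hperm)
  rw [hU, cp_filter] at w2
  obtain ⟨W', l, rfl, hW', hl⟩ := List.map_eq_append_iff.1 w1
  obtain ⟨⟨c00, z⟩, l', rfl, rfl, hl'⟩ := List.map_eq_cons_iff.1 hl
  have : l' = [] := by simpa using hl'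
  subst this
  set L := lam ℓ U with hL
  obtain ⟨f, f1, f2⟩ := up_RH hℓ hk h c L z (w3 (c00, z) (by simp)) hco.le W' hW'
    (fun e he => w3 e (by simp [he])) (2 * L) (2 * c) (by
      intro W1 W2 h12
      have e1 := w4 W1 (W2 ++ [(c00, z)]) (by rw [h12]; simp)
      have e2 := w4 [] (W' ++ [(c00, z)]) rfl
      have e3 : cp k W1 = cp k (W' ++ [(c00, z)]) * (cp k (W2 ++ [(c00, z)]))⁻¹ := by
        rw [h12]; simp only [cp_append]; group
      rw [e3]
      have := hℓ.mul (cp k (W' ++ [(c00, z)])) (cp k (W2 ++ [(c00, z)]))⁻¹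
      have := hℓ.inv (cp k (W2 ++ [(c00, z)]))
      omega) H hH hHm
  refine ⟨f, ?_, ?_⟩
  · have e1 : hp H * cp k (W' ++ [(c00, z)]) = 1 := by
      rw [w2, hT1]; simpa using hval.symm
    simp only [cp_append, cp_cons, cp_nil, mul_one] at e1
    have : z * ev f k Q = z := by
      rw [f1]
      have e2 : hp H * (cp k W' * (z * cv k c00)) = (hp H * (cp k W' * (z * cv k c00 * z⁻¹))) * z := by group
      rw [e2, e1, one_mul]
    simpa using this
  · intro v
    obtain ⟨y, y1, y2⟩ := f2.mem (Sum.inl (v, true)) (hQ.2 _)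
    have e1 := hℓ.mul y⁻¹ (y * gv f k (Sum.inl (v, true)))
    rw [inv_mul_cancel_left] at e1
    change ℓ (f v) ≤ _ at e1
    have e2 := hℓ.inv y
    have e3 : ℓ (f v) ≤ 2 * (4 * (2 * c) * g + (2 * L + (L + c))) := by omega
    have e4 : 2 * g ≤ n := by omega
    have e5 : c ≤ c ^ 2 := Nat.le_self_pow (by norm_num) c
    nlinarith [Nat.zero_le (n * c), Nat.zero_le (n^2), Nat.mul_le_mul_left c e4]

end comb

section asm
variable {r k : ℕ} {ranks : Fin k → ℕ}

/-- products of generators and inverses -/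
def GP (r k : ℕ) (ranks : Fin k → ℕ) (l : List (G r k ranks)) : Prop :=
  ∀ y ∈ l, ∃ b, y = gen r k ranks b ∨ y = (gen r k ranks b)⁻¹

theorem GP_append {l l' : List (G r k ranks)} (h : GP r k ranks l) (h' : GP r k ranks l') :
    GP r k ranks (l ++ l') := by
  intro y hy
  rcases List.mem_append.1 hy with hy | hy
  exacts [h y hy, h' y hy]

theorem GP_inv {l : List (G r k ranks)} (h : GP r k ranks l) :
    GP r k ranks (l.map fun x => x⁻¹).reverse := by
  intro y hy
  rw [List.mem_reverse, List.mem_map] at hy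
  obtain ⟨x, hx, rfl⟩ := hy
  obtain ⟨b, hb⟩ := h x hx
  refine ⟨b, ?_⟩
  rcases hb with rfl | rfl
  · right; rfl
  · left; simp

/-- the subgroup generated by the generators -/
def genSub (r k : ℕ) (ranks : Fin k → ℕ) : Subgroup (G r k ranks) where
  carrier := {x | ∃ l, GP r k ranks l ∧ l.prod = x}
  one_mem' := ⟨[], by intro y hy; simp at hy, rfl⟩
  mul_mem' := by
    rintro x y ⟨l, h1, rfl⟩ ⟨l', h2, rfl⟩
    exact ⟨l ++ l', GP_append h1 h2, by simp⟩
  inv_mem' := by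
    rintro x ⟨l, h1, rfl⟩
    exact ⟨_, GP_inv h1, by rw [List.prod_inv_reverse]⟩

theorem gen_mem_genSub (b : B r k ranks) : gen r k ranks b ∈ genSub r k ranks :=
  ⟨[gen r k ranks b], by intro y hy; exact ⟨b, Or.inl (by simpa using hy)⟩, by simp⟩

theorem genSub_top (x : G r k ranks) : x ∈ genSub r k ranks := by
  induction x using Monoid.CoprodI.induction_on with
  | one => exact one_mem _
  | mul x y hx hy => exact mul_mem hx hy
  | of i m =>
    cases i with
    | none =>
      have key : ∀ m : FreeGroup (Fin r),
          (Monoid.CoprodI.of (M := Fam r k ranks) (i := none)) m ∈ genSub r k ranks := by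
        intro m
        induction m using FreeGroup.induction_on with
        | C1 => exact (map_one (Monoid.CoprodI.of (M := Fam r k ranks) (i := none))).symm ▸ one_mem _
        | of x => exact gen_mem_genSub (Sum.inl x)
        | inv_of x hx =>
          have e := map_inv (Monoid.CoprodI.of (M := Fam r k ranks) (i := none)) (FreeGroup.of x)
          exact e.symm ▸ inv_mem hx
        | mul x y hx hy =>
          have e := map_mul (Monoid.CoprodI.of (M := Fam r k ranks) (i := none)) x y
          exact e.symm ▸ mul_mem hx hy
      exact key m
    | some i =>
      have key : ∀ m : (Fin (ranks i) →₀ ℤ),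
          (Monoid.CoprodI.of (M := Fam r k ranks) (i := some i)) (Multiplicative.ofAdd m)
            ∈ genSub r k ranks := by
        intro m
        induction m using Finsupp.induction_linear with
        | zero => exact (map_one (Monoid.CoprodI.of (M := Fam r k ranks) (i := some i))).symm ▸ one_mem _
        | add x y hx hy =>
          have e := map_mul (Monoid.CoprodI.of (M := Fam r k ranks) (i := some i))
            (Multiplicative.ofAdd x) (Multiplicative.ofAdd y)
          exact e.symm ▸ mul_mem hx hy
        | single j n =>
          have e := map_zpow (Monoid.CoprodI.of (M := Fam r k ranks) (i := some i))
            (Multiplicative.ofAdd (Finsupp.single j (1 : ℤ))) n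
          have e2 : (Multiplicative.ofAdd (Finsupp.single j n) : Multiplicative (Fin (ranks i) →₀ ℤ))
              = (Multiplicative.ofAdd (Finsupp.single j (1 : ℤ))) ^ n := by
            rw [← ofAdd_zsmul]; simp
          have e3 : (Monoid.CoprodI.of (M := Fam r k ranks) (i := some i)) (Multiplicative.ofAdd (Finsupp.single j n))
              = (gen r k ranks (Sum.inr ⟨i, j⟩)) ^ n :=
            (congrArg (Monoid.CoprodI.of (M := Fam r k ranks) (i := some i)) e2).trans e
          exact e3.symm ▸ zpow_mem (gen_mem_genSub (Sum.inr ⟨i, j⟩)) n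
      exact key m

theorem wl_le {l : List (G r k ranks)} (h : GP r k ranks l) : wl r k ranks l.prod ≤ l.length :=
  Nat.sInf_le ⟨l, rfl, h, rfl⟩

theorem wl_spec (x : G r k ranks) : ∃ l, l.length = wl r k ranks x ∧ GP r k ranks l ∧ l.prod = x := by
  obtain ⟨l, h1, h2⟩ := genSub_top x
  exact Nat.sInf_mem (s := {n | ∃ l : List (G r k ranks), l.length = n ∧
    (∀ y ∈ l, ∃ b, y = gen r k ranks b ∨ y = (gen r k ranks b)⁻¹) ∧ l.prod = x}) ⟨_, l, rfl, h1, h2⟩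

theorem wl_inv_le (x : G r k ranks) : wl r k ranks x⁻¹ ≤ wl r k ranks x := by
  obtain ⟨l, h1, h2, rfl⟩ := wl_spec x
  rw [← h1, List.prod_inv_reverse]
  refine (wl_le (GP_inv h2)).trans ?_
  simp

theorem wl_len : Len (wl r k ranks) where
  one := by
    have := wl_le (r := r) (k := k) (ranks := ranks) (l := []) (by intro y hy; simp at hy)
    simpa using this
  mul := by
    intro x y
    obtain ⟨l, h1, h2, rfl⟩ := wl_spec x
    obtain ⟨l', h1', h2', rfl⟩ := wl_spec y
    rw [← h1, ← h1', ← List.prod_append, ← List.length_append]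
    exact wl_le (GP_append h2 h2')
  inv := by
    intro x
    refine le_antisymm (wl_inv_le x) ?_
    have := wl_inv_le x⁻¹
    rwa [inv_inv] at this

theorem wl_gen (b : B r k ranks) : wl r k ranks (gen r k ranks b) ≤ 1 := by
  have := wl_le (r := r) (k := k) (ranks := ranks) (l := [gen r k ranks b])
    (by intro y hy; exact ⟨b, Or.inl (by simpa using hy)⟩)
  simpa using this

/-- commutative factors -/
def FamC (r k : ℕ) (ranks : Fin k → ℕ) : Fin r ⊕ Fin k → Type
  | Sum.inl _ => Multiplicative ℤ
  | Sum.inr i => Multiplicative (Fin (ranks i) →₀ ℤ)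

noncomputable instance famCGroup (r k : ℕ) (ranks : Fin k → ℕ) :
    (i : Fin r ⊕ Fin k) → CommGroup (FamC r k ranks i)
  | Sum.inl _ => inferInstanceAs (CommGroup (Multiplicative ℤ))
  | Sum.inr i => inferInstanceAs (CommGroup (Multiplicative (Fin (ranks i) →₀ ℤ)))

noncomputable def famCDec (r k : ℕ) (ranks : Fin k → ℕ) (i : Fin r ⊕ Fin k) :
    DecidableEq (FamC r k ranks i) := Classical.decEq _

abbrev GC (r k : ℕ) (ranks : Fin k → ℕ) : Type := Monoid.CoprodI (FamC r k ranks)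

noncomputable def genC (r k : ℕ) (ranks : Fin k → ℕ) : B r k ranks → GC r k ranks
  | Sum.inl j => Monoid.CoprodI.of (M := FamC r k ranks) (i := Sum.inl j)
      (show FamC r k ranks (Sum.inl j) from Multiplicative.ofAdd (1 : ℤ))
  | Sum.inr ⟨i, j⟩ => Monoid.CoprodI.of (M := FamC r k ranks) (i := Sum.inr i)
      (show FamC r k ranks (Sum.inr i) from Multiplicative.ofAdd (Finsupp.single j (1 : ℤ)))

noncomputable def toC0 (r k : ℕ) (ranks : Fin k → ℕ) :
    (i : Option (Fin k)) → Fam r k ranks i →* GC r k ranks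
  | none => (FreeGroup.lift (fun j => genC r k ranks (Sum.inl j)) : FreeGroup (Fin r) →* GC r k ranks)
  | some i => Monoid.CoprodI.of (M := FamC r k ranks) (i := Sum.inr i)

noncomputable def toC (r k : ℕ) (ranks : Fin k → ℕ) : G r k ranks →* GC r k ranks :=
  Monoid.CoprodI.lift (toC0 r k ranks)

noncomputable def ofC0 (r k : ℕ) (ranks : Fin k → ℕ) :
    (i : Fin r ⊕ Fin k) → FamC r k ranks i →* G r k ranks
  | Sum.inl j => (zpowersHom (G r k ranks) (gen r k ranks (Sum.inl j)) :
      Multiplicative ℤ →* G r k ranks)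
  | Sum.inr i => Monoid.CoprodI.of (M := Fam r k ranks) (i := some i)

noncomputable def ofC (r k : ℕ) (ranks : Fin k → ℕ) : GC r k ranks →* G r k ranks :=
  Monoid.CoprodI.lift (ofC0 r k ranks)

theorem toC_gen (b : B r k ranks) : toC r k ranks (gen r k ranks b) = genC r k ranks b := by
  rcases b with j | ⟨i, j⟩
  · refine (Monoid.CoprodI.lift_of (toC0 r k ranks) _).trans ?_
    exact FreeGroup.lift_apply_of
  · exact Monoid.CoprodI.lift_of (toC0 r k ranks) _

theorem ofC_gen (b : B r k ranks) : ofC r k ranks (genC r k ranks b) = gen r k ranks b := by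
  rcases b with j | ⟨i, j⟩
  · refine (Monoid.CoprodI.lift_of (ofC0 r k ranks) _).trans ?_
    exact zpow_one (gen r k ranks (Sum.inl j))
  · exact Monoid.CoprodI.lift_of (ofC0 r k ranks) _

theorem genC_syl (b : B r k ranks) : IsSyl (genC r k ranks b) ∧ IsSyl (genC r k ranks b)⁻¹ := by
  rcases b with j | ⟨i, j⟩
  · exact ⟨Or.inr ⟨_, _, rfl⟩, Or.inr ⟨_, _, (map_inv _ _).symm⟩⟩
  · exact ⟨Or.inr ⟨_, _, rfl⟩, Or.inr ⟨_, _, (map_inv _ _).symm⟩⟩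

end asm

section conv
variable {X Γ Δ : Type} [Group Γ] [Group Δ]

def vl (u : X → Γ) (l : X × Bool) : Γ := cond l.2 (u l.1) (u l.1)⁻¹

theorem hom_eq [DecidableEq X] (α : FreeGroup X →* Γ) (Q : FreeGroup X) :
    α Q = (Q.toWord.map (vl fun x => α (FreeGroup.of x))).prod := by
  have h : α = FreeGroup.lift (fun x => α (FreeGroup.of x)) := by
    ext x; simp
  conv_lhs => rw [h, ← FreeGroup.mk_toWord (x := Q)]
  rw [FreeGroup.lift_mk]
  rfl

theorem vl_map (φ : Γ →* Δ) (u : X → Γ) (l : X × Bool) : φ (vl u l) = vl (fun x => φ (u x)) l := by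
  rcases l with ⟨x, _ | _⟩ <;> simp [vl]

variable {V C β : Type}

theorem ev_hom (φ : Γ →* Δ) (f : V → Γ) (k : C → Γ) (l : List (Lt V C)) :
    φ (ev f k l) = ev (fun v => φ (f v)) (fun c => φ (k c)) l := by
  induction l with
  | nil => simp
  | cons x l ih =>
    rw [ev_cons, ev_cons, map_mul, ih]
    congr 1
    rcases x with ⟨v, _ | _⟩ | c <;> simp [gv]

theorem cv_hom (φ : Γ →* Δ) (k : C → Γ) (l : List C) :
    φ (cv k l) = cv (fun c => φ (k c)) l := by
  induction l with
  | nil => simp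
  | cons x l ih => rw [cv_cons, cv_cons, map_mul, ih]

/-- coefficient positions -/
abbrev Pos (L : List ((V ⊕ β) × Bool)) : Type := {i : Fin L.length // (L.get i).1.isRight = true}

def enc (L : List ((V ⊕ β) × Bool)) (i : Fin L.length) : Lt V (Pos L) :=
  if h : (L.get i).1.isRight = true then Sum.inr ⟨i, h⟩
  else Sum.inl ((L.get i).1.getLeft (by simpa using h), (L.get i).2)

def dec (L : List ((V ⊕ β) × Bool)) : Lt V (Pos L) → (V ⊕ β) × Bool
  | Sum.inl (x, s) => (Sum.inl x, s)
  | Sum.inr c => L.get c.1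

theorem dec_enc (L : List ((V ⊕ β) × Bool)) (i : Fin L.length) : dec L (enc L i) = L.get i := by
  unfold enc
  split_ifs with h
  · rfl
  · simp [dec]

theorem enc_of_left (L : List ((V ⊕ β) × Bool)) (i : Fin L.length) (x : V) (s : Bool)
    (h : L.get i = (Sum.inl x, s)) : enc L i = Sum.inl (x, s) := by
  have h1 : ¬ (L.get i).1.isRight = true := by rw [h]; simp
  have h2 := dec_enc L i
  unfold enc at h2 ⊢
  rw [dif_neg h1] at h2 ⊢
  replace h2 := h2.trans h
  simp only [dec, Prod.mk.injEq, Sum.inl.injEq] at h2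
  rw [Sum.inl.injEq, Prod.mk.injEq]
  exact h2

def encW (L : List ((V ⊕ β) × Bool)) : List (Lt V (Pos L)) := (List.finRange L.length).map (enc L)

theorem encW_dec (L : List ((V ⊕ β) × Bool)) : (encW L).map (dec L) = L := by
  unfold encW
  rw [List.map_map]
  have : dec L ∘ enc L = L.get := by funext i; exact dec_enc L i
  rw [this]
  exact List.map_get_finRange L

theorem encW_full (L : List ((V ⊕ β) × Bool))
    (hm : ∀ x s, (Sum.inl x, s) ∈ L) (hd : ∀ x s, ¬ List.Sublist [(Sum.inl x, s), (Sum.inl x, s)] L) : Full (encW L) := by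
  constructor
  · refine List.Nodup.map ?_ (List.nodup_finRange _)
    intro i j hij
    have e : L.get i = L.get j := by rw [← dec_enc, hij, dec_enc]
    by_cases hr : (L.get i).1.isRight = true
    · have hr' : (L.get j).1.isRight = true := by rw [← e]; exact hr
      unfold enc at hij
      rw [dif_pos hr, dif_pos hr'] at hij
      simpa using hij
    · obtain ⟨x, s, hx⟩ : ∃ x s, L.get i = (Sum.inl x, s) := by
        rcases hh : L.get i with ⟨x | b, s⟩
        · exact ⟨x, s, rfl⟩
        · rw [hh] at hr; simp at hr
      by_contra hne
      have hdd : List.Duplicate (Sum.inl x, s) L := by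
        rw [List.duplicate_iff_exists_distinct_get]
        rcases lt_or_gt_of_ne hne with hlt | hlt
        · exact ⟨i, j, hlt, hx.symm, by rw [← hx, e]⟩
        · exact ⟨j, i, hlt, by rw [← hx, e], hx.symm⟩
      exact hd x s (List.duplicate_iff_sublist.1 hdd)
  · rintro (⟨x, s⟩ | c)
    · obtain ⟨i, hi⟩ := List.get_of_mem (hm x s)
      exact List.mem_map.2 ⟨i, List.mem_finRange i, enc_of_left L i x s hi⟩
    · refine List.mem_map.2 ⟨c.1, List.mem_finRange _, ?_⟩
      unfold enc
      rw [dif_pos c.2]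

theorem co_countP (l : List (Lt V C)) : (co l).length = l.countP Sum.isRight := by
  induction l with
  | nil => simp
  | cons x l ih =>
    rcases x with x | x
    · rw [co_cons_inl, ih, List.countP_cons_of_neg (by simp)]
    · rw [co_cons_inr, List.length_cons, ih, List.countP_cons_of_pos (by simp)]

theorem encW_card [Fintype V] [DecidableEq V] (L : List ((V ⊕ β) × Bool)) (h : Full (encW L)) :
    Fintype.card (Pos L) = (L.filter fun l => l.1.isRight).length := by
  classical
  rw [← h.co_length, co_countP, ← List.countP_eq_length_filter]
  conv_rhs => rw [← encW_dec L, List.countP_map]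
  apply List.countP_congr
  rintro (⟨x, s⟩ | c) _
  · simp [dec]
  · have := c.2
    simp only [dec, Function.comp, Sum.isRight_inr]
    exact ⟨fun _ => this, fun _ => trivial⟩

theorem ev_encW (L : List ((V ⊕ β) × Bool)) (u u0 : V ⊕ β → Γ) (hu : ∀ b, u (Sum.inr b) = u0 (Sum.inr b)) :
    (L.map (vl u)).prod = ev (fun v => u (Sum.inl v)) (fun c => vl u0 (L.get c.1)) (encW L) := by
  conv_lhs => rw [← encW_dec L]
  rw [List.map_map, ev]
  congr 1
  apply List.map_congr_left
  rintro (⟨x, _ | _⟩ | c) _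
  · rfl
  · rfl
  · have hc := c.2
    change vl u (L.get c.1) = vl u0 (L.get c.1)
    rcases hh : L.get c.1 with ⟨x | b, s⟩
    · rw [hh] at hc; simp at hc
    · simp [vl, hu]

end conv

/-- Every solvable orientable quadratic equation Q = 1 over the free product G has a
solution α with |α(x)| ≤ N·(n(Q)+c(Q))² for every variable x, where N depends only on G. -/
theorem orientable_quadratic_minimal_solution_bound (r k : ℕ) (ranks : Fin k → ℕ) :
    ∃ N : ℕ, ∀ (nv : ℕ) (Q : FreeGroup (Fin nv ⊕ B r k ranks)),
      (∀ x : Fin nv, occ Q x = 2) →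
      (∀ x : Fin nv, occS Q x true = 1 ∧ occS Q x false = 1) →
      (∃ α, IsSol r k ranks Q α) →
      ∃ α, IsSol r k ranks Q α ∧
        ∀ x : Fin nv, wl r k ranks (α (FreeGroup.of (Sum.inl x))) ≤ N * (nv + cLen Q) ^ 2 := by
  refine ⟨100, ?_⟩
  intro nv Q _ hocc hsol
  obtain ⟨α, hα1, hα2⟩ := hsol
  classical
  set L := Q.toWord with hL
  have hone : ∀ x s, (L.filter fun l => decide (l.1 = Sum.inl x) && (l.2 == s)).length = 1 := by
    intro x s
    cases s; exacts [(hocc x).2, (hocc x).1]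
  have hmem : ∀ x s, (Sum.inl x, s) ∈ L := by
    intro x s
    obtain ⟨⟨y, s'⟩, hy⟩ := List.exists_mem_of_length_pos (by rw [hone x s]; exact Nat.one_pos)
    rw [List.mem_filter] at hy
    obtain ⟨hy1, hy2⟩ := hy
    simp only [Bool.and_eq_true, decide_eq_true_eq, beq_iff_eq] at hy2
    rw [← hy2.1, ← hy2.2]
    exact hy1
  have hdup : ∀ x s, ¬ List.Sublist [(Sum.inl x, s), (Sum.inl x, s)] L := by
    intro x s hsub
    have h1 := (hsub.filter fun l => decide (l.1 = Sum.inl x) && (l.2 == s)).length_le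
    rw [hone x s] at h1
    simp at h1
  have hfull := encW_full L hmem hdup
  have hcard : Fintype.card (Pos L) = cLen Q := encW_card L hfull
  set u0 : Fin nv ⊕ B r k ranks → G r k ranks := Sum.elim (fun _ => 1) (gen r k ranks) with hu0
  set kG : Pos L → G r k ranks := fun c => vl u0 (L.get c.1) with hkG
  have hpos : ∀ c : Pos L, ∃ b, kG c = gen r k ranks b ∨ kG c = (gen r k ranks b)⁻¹ := by
    intro c
    have hc := c.2
    rcases hh : L.get c.1 with ⟨x | b, s⟩
    · rw [hh] at hc; simp at hc
    · refine ⟨b, ?_⟩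
      simp only [hkG, hh, hu0, vl, Sum.elim_inr]
      cases s
      · right; rfl
      · left; rfl
  have hk1 : ∀ c, wl r k ranks (kG c) ≤ 1 := by
    intro c
    obtain ⟨b, hb | hb⟩ := hpos c
    · rw [hb]; exact wl_gen b
    · rw [hb, wl_len.inv]; exact wl_gen b
  have hsyl : ∀ c, IsSyl (toC r k ranks (kG c)) := by
    intro c
    obtain ⟨b, hb | hb⟩ := hpos c
    · rw [hb, toC_gen]; exact (genC_syl b).1
    · rw [hb, map_inv, toC_gen]; exact (genC_syl b).2
  have hret : ∀ c, ofC r k ranks (toC r k ranks (kG c)) = kG c := by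
    intro c
    obtain ⟨b, hb | hb⟩ := hpos c
    · rw [hb, toC_gen, ofC_gen]
    · rw [hb, map_inv, map_inv, toC_gen, ofC_gen]
  rw [hom_eq, ev_encW Q.toWord _ u0 (fun b => by simp [hα1, hu0])] at hα2
  have hα3 := congrArg (toC r k ranks) hα2
  rw [ev_hom, map_one] at hα3
  obtain ⟨V', i1, i2, Q', q1, q2, q3⟩ := collapse_all (fun c => toC r k ranks (kG c)) hsyl _ (encW L) hfull hα3
  have q4 := congrArg (ofC r k ranks) q3
  rw [cv_hom, map_one] at q4
  simp only [hret] at q4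
  obtain ⟨f, f1, f2⟩ := final_bound wl_len hk1 (encW L) Q' hfull q1 q2 q4
  refine ⟨FreeGroup.lift (Sum.elim f (gen r k ranks)), ⟨?_, ?_⟩, ?_⟩
  · intro b; simp
  · rw [hom_eq, ev_encW Q.toWord _ u0 (fun b => by simp [hu0])]
    simp only [FreeGroup.lift_apply_of, Sum.elim_inl]
    exact f1
  · intro x
    have := f2 x
    rw [hcard, Fintype.card_fin] at this
    simpa using this

end Stmt0
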